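/- Let α be irrational with continued-fraction denominators q_k, let f : ℝ → ℝ be 1-periodic with 𝒱(f) < ∞ and log F ∈ L¹[0,1) where F(x) := 1 + |f(x)|, and let ε > 0. Suppose q_{n_j} is a subsequence of the denominators such that Σ_{j=1}^{∞} ∫_{{x ∈ [0,1) : F(x) > e^{ε q_{n_j}/10}}} log F(x) dx < ∞. Then there exists a full-measure subset X_tel ⊆ [0,1) such that for every x ∈ X_tel and every E ∈ ℝ, the sequence {q_{n_j}} is (L(E)+ε)-telescopic for the potential V(n) = f(x + nα). -/

import Mathlib

open MeasureTheory Filter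
open scoped ENNReal NNReal

noncomputable section

attribute [local instance] Matrix.linftyOpNormedRing

/-- The truncation `[f]_B` of a real-valued function: `[f]_B x = f x` if `|f x| ≤ B`,
and `B` otherwise. -/
def trunc (f : ℝ → ℝ) (B : ℝ) : ℝ → ℝ := fun x => if |f x| ≤ B then f x else B

/-- The total variation of a `1`-periodic function over the period `[0,1]`. -/
def pVar (f : ℝ → ℝ) : ℝ≥0∞ := eVariationOn f (Set.Icc 0 1)

/-- The semi-bounded variation `𝒱(f) = sup_{B ≥ 1} (1/B) Var [f]_B`. -/
def sVar (f : ℝ → ℝ) : ℝ≥0∞ :=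
  ⨆ B : {B : ℝ // 1 ≤ B}, (ENNReal.ofReal B.1)⁻¹ * pVar (trunc f B.1)

/-- Iterates of the Gauss map, starting from the fractional part of `α`. -/
def gaussIter (α : ℝ) : ℕ → ℝ
  | 0 => Int.fract α
  | (k+1) => Int.fract (gaussIter α k)⁻¹

/-- The continued fraction digit `a_{k+1}` of `α`. -/
def cfA (α : ℝ) (k : ℕ) : ℕ := ⌊(gaussIter α k)⁻¹⌋₊

/-- The denominators `q_k` of the continued fraction approximants of `α`:
`q₀ = 1`, `q₁ = a₁`, `q_{k+1} = a_{k+1} q_k + q_{k-1}`. -/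
def cfDen (α : ℝ) : ℕ → ℕ
  | 0 => 1
  | 1 => cfA α 0
  | (k+2) => cfA α (k+1) * cfDen α (k+1) + cfDen α k

/-- The `n`-step transfer matrix `S_n^{f,E}(x) = S^{f,E}(x+(n-1)α) ⋯ S^{f,E}(x)` of the
quasiperiodic Schrödinger cocycle, where `S^{f,E}(y) = [[E - f y, -1], [1, 0]]`. -/
def schCocycle (α : ℝ) (f : ℝ → ℝ) (E : ℝ) (n : ℕ) (x : ℝ) :
    Matrix (Fin 2) (Fin 2) ℂ :=
  ((List.range n).map fun k =>
    !![((E : ℂ) - (f (x + ((n - 1 - k : ℕ) : ℝ) * α) : ℂ)), -1; 1, 0]).prod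

/-- The one-step transfer matrix `A_m(E) = [[E - V m, -1], [1, 0]]`. -/
def tMat (V : ℤ → ℂ) (E : ℂ) (m : ℤ) : Matrix (Fin 2) (Fin 2) ℂ :=
  !![E - V m, -1; 1, 0]

/-- The ordered product `A_{n-1}(E) A_{n-2}(E) ⋯ A_k(E)` (for `k ≤ n`). -/
def tProd (V : ℤ → ℂ) (E : ℂ) (n k : ℤ) : Matrix (Fin 2) (Fin 2) ℂ :=
  ((List.range (n - k).toNat).map fun j => tMat V E (n - 1 - j)).prod

/-- The multi-step transfer matrix `M_{n,k}(E)`: the ordered product for `k ≤ n`, and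
the inverse `M_{k,n}(E)⁻¹` for `k > n`. -/
def tM (V : ℤ → ℂ) (E : ℂ) (n k : ℤ) : Matrix (Fin 2) (Fin 2) ℂ :=
  if k ≤ n then tProd V E n k else (tProd V E k n)⁻¹

/-- The sequence `{q n}` is `λ`-telescopic for `V` at `E`. -/
def telescopic (V : ℤ → ℂ) (E : ℂ) (lam : ℝ) (q : ℕ → ℕ) : Prop :=
  ∃ N : ℕ, ∀ n ≥ N, ∀ s : ℤ, 0 ≤ s → s < (q n : ℤ) →
    ‖tM V E (2 * (q n : ℤ)) ((q n : ℤ) + s + 1)‖ * ‖tM V E s 0‖ ≤ Real.exp (lam * q n) ∧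
    ‖tM V E (-(q n : ℤ)) (-(q n : ℤ) + s - 1)‖ * ‖tM V E s (q n : ℤ)‖ ≤ Real.exp (lam * q n)


/-! ### Continued fractions -/

lemma gauss_irr (α : ℝ) (hα : Irrational α) (k : ℕ) : Irrational (gaussIter α k) := by
  induction k with
  | zero =>
    simp only [gaussIter, Int.fract]
    exact hα.sub_intCast _
  | succ k ih =>
    simp only [gaussIter, Int.fract]
    exact (Irrational.inv ih).sub_intCast _

lemma gauss_pos (α : ℝ) (hα : Irrational α) (k : ℕ) : 0 < gaussIter α k := by
  have h := (gauss_irr α hα k).ne_zero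
  have h2 : 0 ≤ gaussIter α k := by
    cases k <;> exact Int.fract_nonneg _
  exact lt_of_le_of_ne h2 (Ne.symm h)

lemma gauss_lt_one (α : ℝ) (k : ℕ) : gaussIter α k < 1 := by
  cases k <;> exact Int.fract_lt_one _

lemma cfA_pos (α : ℝ) (hα : Irrational α) (k : ℕ) : 1 ≤ cfA α k := by
  unfold cfA
  apply Nat.le_floor
  rw [Nat.cast_one]
  exact (one_le_inv₀ (gauss_pos α hα k)).2 (gauss_lt_one α k).le

lemma gauss_inv (α : ℝ) (hα : Irrational α) (k : ℕ) :
    (gaussIter α k)⁻¹ = cfA α k + gaussIter α (k + 1) := by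
  have h : (0 : ℝ) ≤ (gaussIter α k)⁻¹ := (inv_pos.2 (gauss_pos α hα k)).le
  simp only [gaussIter, cfA]
  rw [natCast_floor_eq_intCast_floor h, Int.floor_add_fract]

/-- Numerators. -/
def cfNum (α : ℝ) : ℕ → ℤ
  | 0 => ⌊α⌋
  | 1 => cfA α 0 * ⌊α⌋ + 1
  | (k+2) => cfA α (k+1) * cfNum α (k+1) + cfNum α k

lemma gauss_mul (α : ℝ) (hα : Irrational α) (k : ℕ) :
    gaussIter α k * (cfA α k + gaussIter α (k + 1)) = 1 := by
  rw [← gauss_inv α hα k]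
  exact mul_inv_cancel₀ (gauss_pos α hα k).ne'

lemma cf_rel (α : ℝ) (hα : Irrational α) (k : ℕ) :
    α * (cfDen α (k+1) + gaussIter α (k+1) * cfDen α k) =
      cfNum α (k+1) + gaussIter α (k+1) * cfNum α k := by
  induction k with
  | zero =>
    have h := gauss_mul α hα 0
    have h0 : gaussIter α 0 = α - ⌊α⌋ := rfl
    rw [h0] at h
    simp only [cfDen, cfNum, zero_add]
    push_cast
    simp only [zero_add] at h
    linear_combination h
  | succ k ih =>
    have h := gauss_mul α hα (k+1)
    have e : cfDen α (k+1+1) = cfA α (k+1) * cfDen α (k+1) + cfDen α k := rfl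
    have e' : cfNum α (k+1+1) = cfA α (k+1) * cfNum α (k+1) + cfNum α k := rfl
    rw [e, e']
    push_cast
    linear_combination (cfA α (k+1) + gaussIter α (k+1+1)) * ih +
      (cfNum α k - α * cfDen α k) * h

lemma cf_det (α : ℝ) (k : ℕ) :
    cfNum α (k+1) * cfDen α k - cfNum α k * cfDen α (k+1) = (-1) ^ k := by
  induction k with
  | zero => simp [cfNum, cfDen]; ring
  | succ k ih =>
    have e : cfDen α (k+1+1) = cfA α (k+1) * cfDen α (k+1) + cfDen α k := rfl
    have e' : cfNum α (k+1+1) = cfA α (k+1) * cfNum α (k+1) + cfNum α k := rfl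
    rw [e, e', pow_succ]
    push_cast
    linear_combination -ih

lemma cfDen_pos (α : ℝ) (hα : Irrational α) : ∀ k, 0 < cfDen α k
  | 0 => Nat.one_pos
  | 1 => cfA_pos α hα 0
  | (k+2) => by
    simp only [cfDen]
    have := cfDen_pos α hα k
    omega

lemma cfDen_le (α : ℝ) (hα : Irrational α) (k : ℕ) : cfDen α k ≤ cfDen α (k+1) := by
  cases k with
  | zero => exact cfA_pos α hα 0
  | succ k =>
    have e : cfDen α (k+1+1) = cfA α (k+1) * cfDen α (k+1) + cfDen α k := rfl
    have := Nat.mul_le_mul_right (cfDen α (k+1)) (cfA_pos α hα (k+1))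
    omega

lemma cfDen_ge (α : ℝ) (hα : Irrational α) (k : ℕ) : k ≤ cfDen α k := by
  induction k with
  | zero => omega
  | succ k ih =>
    cases k with
    | zero => exact cfA_pos α hα 0
    | succ k =>
      have e : cfDen α (k+1+1) = cfA α (k+1) * cfDen α (k+1) + cfDen α k := rfl
      have := Nat.mul_le_mul_right (cfDen α (k+1)) (cfA_pos α hα (k+1))
      have := cfDen_pos α hα k
      omega

lemma cf_approx (α : ℝ) (hα : Irrational α) (k : ℕ) :
    ∃ p : ℤ, IsCoprime p (cfDen α k : ℤ) ∧ |α * cfDen α k - p| * cfDen α k ≤ 1 := by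
  refine ⟨cfNum α k, ?_, ?_⟩
  · have h := cf_det α k
    refine ⟨-(-1) ^ k * cfDen α (k+1), (-1) ^ k * cfNum α (k+1), ?_⟩
    have h2 : ((-1 : ℤ) ^ k) * (-1) ^ k = 1 := by
      rw [← mul_pow]; simp
    linear_combination (-1 : ℤ) ^ k * h + h2
  · have h1 := cf_rel α hα k
    have h2 : (cfNum α (k+1) * cfDen α k - cfNum α k * cfDen α (k+1) : ℝ) = (-1) ^ k := by
      exact_mod_cast cf_det α k
    have hg := gauss_pos α hα (k+1)
    have hq : (0 : ℝ) < cfDen α k := by exact_mod_cast cfDen_pos α hα k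
    have hq1 : (cfDen α k : ℝ) ≤ cfDen α (k+1) := by exact_mod_cast cfDen_le α hα k
    have h3 : (α * cfDen α k - cfNum α k) * (cfDen α (k+1) + gaussIter α (k+1) * cfDen α k)
        = (-1) ^ k := by
      linear_combination cfDen α k * h1 + h2
    have h4 := congrArg abs h3
    rw [abs_mul, abs_pow, abs_neg, abs_one, one_pow] at h4
    rw [← h4]
    apply mul_le_mul_of_nonneg_left _ (abs_nonneg _)
    apply le_trans _ (le_abs_self _)
    have := mul_pos hg hq
    linarith

/-! ### Denjoy-Koksma -/

/-- Periodic bounded variation, in terms of a dominating monotone function. -/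
def BVp {β : Type*} [NormedAddCommGroup β] (g : ℝ → β) (W : ℝ) : Prop :=
  ∃ v : ℝ → ℝ, (∀ a b, a ≤ b → ‖g b - g a‖ ≤ v b - v a) ∧ ∀ t, v (t + 1) = v t + W

lemma BVp.nonneg {β : Type*} [NormedAddCommGroup β] {g : ℝ → β} {W : ℝ} (h : BVp g W) :
    0 ≤ W := by
  obtain ⟨v, hv, hp⟩ := h
  have := hv 0 1 zero_le_one
  have h2 := hp 0
  rw [zero_add] at h2
  linarith [norm_nonneg (g 1 - g 0)]

lemma BVp.intervalIntegrable {g : ℝ → ℝ} {W : ℝ} (h : BVp g W) (a b : ℝ) :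
    IntervalIntegrable g volume a b := by
  obtain ⟨v, hv, hp⟩ := h
  have m1 : Monotone v := fun x y hxy => by
    have := hv x y hxy
    linarith [norm_nonneg (g y - g x)]
  have m2 : Monotone (fun x => g x + v x) := fun x y hxy => by
    have := hv x y hxy
    rw [Real.norm_eq_abs] at this
    have := (abs_le.1 this).1
    show g x + v x ≤ g y + v y
    linarith
  have := (m2.intervalIntegrable (μ := volume) (a := a) (b := b)).sub
    (m1.intervalIntegrable (μ := volume) (a := a) (b := b))
  simpa using this

lemma BVp.integrableOn {g : ℝ → ℝ} {W : ℝ} (h : BVp g W) :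
    IntegrableOn g (Set.Ico 0 1) volume := by
  have := (h.intervalIntegrable 0 1).1
  exact (integrableOn_Ico_iff_integrableOn_Ioo).2 ((integrableOn_Ioc_iff_integrableOn_Ioo).1 this)

lemma sum_residue (h : ℤ → ℝ) (h0 : ∀ r, 0 ≤ h r) (q : ℕ) (hq : 0 < q)
    (hper : ∀ r, h (r + q) = h r) (p : ℤ) (hcop : IsCoprime p (q : ℤ)) (K : Finset ℤ)
    (hinj : ∀ k ∈ K, ∀ l ∈ K, (q : ℤ) ∣ k - l → k = l) :
    ∑ k ∈ K, h (k * p) ≤ ∑ r ∈ Finset.range q, h r := by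
  have hP : Function.Periodic h (q : ℤ) := hper
  have hq' : (0 : ℤ) < q := by exact_mod_cast hq
  have hmod : ∀ n, h ((n % (q : ℤ)).toNat : ℤ) = h n := by
    intro n
    rw [Int.toNat_of_nonneg (Int.emod_nonneg _ hq'.ne')]
    have := hP.sub_zsmul_eq (x := n) (n / (q : ℤ))
    rw [← this]
    congr 1
    have := Int.emod_add_mul_ediv n q
    rw [smul_eq_mul]
    linarith
  have h1 : ∑ k ∈ K, h (k * p) = ∑ k ∈ K, h (((k * p) % (q : ℤ)).toNat : ℤ) :=
    Finset.sum_congr rfl fun k _ => (hmod _).symm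
  rw [h1]
  have h2 : Set.InjOn (fun k : ℤ => ((k * p) % (q : ℤ)).toNat) K := by
    intro k hk l hl hkl
    apply hinj k hk l hl
    have e : (k * p) % (q : ℤ) = (l * p) % (q : ℤ) := by
      have := congrArg (Nat.cast : ℕ → ℤ) hkl
      simp only [] at this
      rwa [Int.toNat_of_nonneg (Int.emod_nonneg _ hq'.ne'),
        Int.toNat_of_nonneg (Int.emod_nonneg _ hq'.ne')] at this
    have d : (q : ℤ) ∣ (k - l) * p := by
      have := Int.ModEq.dvd (show l * p ≡ k * p [ZMOD q] from e.symm)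
      rwa [sub_mul]
    exact hcop.symm.dvd_of_dvd_mul_right d
  rw [← Finset.sum_image (f := fun r : ℕ => h r) h2]
  apply Finset.sum_le_sum_of_subset_of_nonneg
  · intro r hr
    obtain ⟨k, _, rfl⟩ := Finset.mem_image.1 hr
    rw [Finset.mem_range]
    have h3 := Int.emod_lt_of_pos (k * p) hq'
    have h4 := Int.emod_nonneg (k * p) hq'.ne'
    omega
  · intro r _ _
    exact h0 r

lemma denjoy_koksma (g : ℝ → ℝ) (hg0 : ∀ y, 0 ≤ g y) (hper : Function.Periodic g 1) (W : ℝ)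
    (hb : BVp g W) (α : ℝ) (q : ℕ) (hq : 0 < q) (p : ℤ) (hcop : IsCoprime p (q : ℤ))
    (happ : |α * q - p| * q ≤ 1) (K : Finset ℤ) (hK : ∀ k ∈ K, |k| ≤ 2 * q)
    (hinj : ∀ k ∈ K, ∀ l ∈ K, (q : ℤ) ∣ k - l → k = l) (x : ℝ) :
    ∑ k ∈ K, g (x + k * α) ≤ q * (∫ y in Set.Ico (0:ℝ) 1, g y) + 4 * W := by
  have hbi := hb.intervalIntegrable
  obtain ⟨v, hv, hvp⟩ := hb
  have hq' : (0 : ℝ) < q := by exact_mod_cast hq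
  have m1 : Monotone v := fun x y hxy => by
    have := hv x y hxy
    linarith [norm_nonneg (g y - g x)]
  have hosc : ∀ l u a b, l ≤ a → a ≤ u → l ≤ b → b ≤ u → g a ≤ g b + (v u - v l) := by
    intro l u a b h1 h2 h3 h4
    rcases le_total a b with hab | hab
    · have := hv a b hab
      rw [Real.norm_eq_abs] at this
      have := (abs_le.1 this).1
      linarith [m1 h1, m1 h4]
    · have := hv b a hab
      rw [Real.norm_eq_abs] at this
      have := (abs_le.1 this).2
      linarith [m1 h3, m1 h2]
  -- the pointwise inequality
  have key : ∀ t ∈ Set.Icc (0:ℝ) (1 / q), ∑ k ∈ K, g (x + k * α) ≤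
      ∑ r ∈ Finset.range q, g (x + r / q + t) + 4 * W := by
    intro t ht
    have s1 : ∑ k ∈ K, g (x + ((k * p : ℤ) : ℝ) / q + t) ≤
        ∑ r ∈ Finset.range q, g (x + ((r : ℤ) : ℝ) / q + t) := by
      refine sum_residue (fun r : ℤ => g (x + (r : ℝ) / q + t)) (fun r => hg0 _) q hq ?_ p hcop K
        hinj
      intro r
      show g (x + ((r + (q : ℤ) : ℤ) : ℝ) / q + t) = _
      rw [← hper (x + (r : ℝ) / q + t)]
      congr 1
      push_cast
      field_simp
      ring
    have s2 : ∑ k ∈ K, (v (x + ((k * p + 2: ℤ) : ℝ) / q) - v (x + ((k * p - 2: ℤ) : ℝ) / q)) ≤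
        ∑ r ∈ Finset.range q, (v (x + (((r : ℤ) + 2 : ℤ) : ℝ) / q)
          - v (x + (((r : ℤ) - 2 : ℤ) : ℝ) / q)) := by
      refine sum_residue (fun r : ℤ => v (x + ((r + 2 : ℤ) : ℝ) / q)
          - v (x + ((r - 2 : ℤ) : ℝ) / q)) (fun r => ?_) q hq ?_ p hcop K hinj
      · apply sub_nonneg.2
        apply m1
        gcongr
        omega
      · intro r
        have e1 : v (x + ((r + q + 2 : ℤ) : ℝ) / q) = v (x + ((r + 2 : ℤ) : ℝ) / q) + W := by
          rw [← hvp]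
          congr 1
          push_cast
          field_simp
          ring
        have e2 : v (x + ((r + q - 2 : ℤ) : ℝ) / q) = v (x + ((r - 2 : ℤ) : ℝ) / q) + W := by
          rw [← hvp]
          congr 1
          push_cast
          field_simp
          ring
        simp only [e1, e2]
        ring
    have s3 : ∑ r ∈ Finset.range q, (v (x + (((r : ℤ) + 2 : ℤ) : ℝ) / q)
          - v (x + (((r : ℤ) - 2 : ℤ) : ℝ) / q)) = 4 * W := by
      have tel : ∀ c : ℤ, ∑ r ∈ Finset.range q, (v (x + (((r : ℤ) + 1 + c : ℤ) : ℝ) / q)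
          - v (x + (((r : ℤ) + c : ℤ) : ℝ) / q)) = W := by
        intro c
        have := Finset.sum_range_sub (fun r : ℕ => v (x + (((r : ℤ) + c : ℤ) : ℝ) / q)) q
        push_cast at this ⊢
        rw [this]
        have e : x + ((q : ℝ) + c) / q = x + (0 + (c : ℝ)) / q + 1 := by
          field_simp
          ring
        rw [e, hvp]
        ring
      have t1 := tel 1
      have t2 := tel 0
      have t3 := tel (-1)
      have t4 := tel (-2)
      have : 4 * W = W + W + W + W := by ring
      rw [this]
      nth_rewrite 1 [← t1]
      nth_rewrite 1 [← t2]
      nth_rewrite 1 [← t3]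
      nth_rewrite 1 [← t4]
      rw [← Finset.sum_add_distrib, ← Finset.sum_add_distrib, ← Finset.sum_add_distrib]
      apply Finset.sum_congr rfl
      intro r _
      have e1 : (r : ℤ) + 1 + 1 = r + 2 := by ring
      have e2 : (r : ℤ) + 1 + 0 = r + 1 := by ring
      have e3 : (r : ℤ) + 1 + -1 = r + 0 := by ring
      have e4 : (r : ℤ) + 1 + -2 = r + -1 := by ring
      have e5 : (r : ℤ) + -2 = r - 2 := by ring
      rw [e1, e2, e3, e4, e5]
      ring
    have s4 : ∑ k ∈ K, g (x + k * α) ≤ ∑ k ∈ K, (g (x + ((k * p : ℤ) : ℝ) / q + t) +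
        (v (x + ((k * p + 2: ℤ) : ℝ) / q) - v (x + ((k * p - 2: ℤ) : ℝ) / q))) := by
      apply Finset.sum_le_sum
      intro k hk
      have hk2 : |(k : ℝ)| ≤ 2 * q := by exact_mod_cast hK k hk
      have d : |k * α - ((k * p : ℤ) : ℝ) / q| ≤ 2 / q := by
        have e : k * α - ((k * p : ℤ) : ℝ) / q = k * (α * q - p) / q := by
          push_cast
          field_simp
        rw [e, abs_div, abs_mul, abs_of_pos hq']
        apply div_le_div_of_nonneg_right _ hq'.le
        calc |(k : ℝ)| * |α * q - p| ≤ 2 * q * |α * q - p| := by gcongr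
          _ = 2 * (|α * q - p| * q) := by ring
          _ ≤ 2 := by linarith
      have d1 := (abs_le.1 d).1
      have d2 := (abs_le.1 d).2
      have i1 : x + ((k * p + 2 : ℤ) : ℝ) / q = x + ((k * p : ℤ) : ℝ) / q + 2 / q := by
        push_cast; ring
      have i2 : x + ((k * p - 2 : ℤ) : ℝ) / q = x + ((k * p : ℤ) : ℝ) / q - 2 / q := by
        push_cast; ring
      have i3 : (1 : ℝ) / q ≤ 2 / q := by gcongr; norm_num
      have i4 : (0 : ℝ) ≤ 2 / q := by positivity
      have := ht.1
      have := ht.2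
      apply hosc
      · rw [i2]; linarith
      · rw [i1]; linarith
      · rw [i2]; linarith
      · rw [i1]; linarith
    rw [Finset.sum_add_distrib] at s4
    have s5 : ∑ r ∈ Finset.range q, g (x + ((r : ℤ) : ℝ) / q + t) =
      ∑ r ∈ Finset.range q, g (x + r / q + t) := by simp
    linarith
  -- integrate
  have hsh : ∀ r : ℕ, IntervalIntegrable (fun t => g (x + r / q + t)) volume 0 (1 / q) := by
    intro r
    have := (hbi (x + r / q + 0) (x + r / q + 1 / q)).comp_add_left (x + r / q)
    simpa using this
  have hsum : IntervalIntegrable (fun t => ∑ r ∈ Finset.range q, g (x + r / q + t))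
      volume 0 (1 / q) := by
    have := IntervalIntegrable.sum (Finset.range q) (f := fun (r : ℕ) t => g (x + r / q + t))
          (fun r _ => hsh r)
    have e : (fun t => ∑ r ∈ Finset.range q, g (x + r / q + t)) =
        ∑ r ∈ Finset.range q, fun t => g (x + r / q + t) := by
      ext t
      simp
    rw [e]
    exact this
  have hI : ∫ t in (0:ℝ)..(1 / q), (∑ k ∈ K, g (x + k * α)) ≤
      ∫ t in (0:ℝ)..(1 / q), (∑ r ∈ Finset.range q, g (x + r / q + t) + 4 * W) := by
    apply intervalIntegral.integral_mono_on (by positivity)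
    · simp
    · apply IntervalIntegrable.add
      · exact hsum
      · simp
    · exact key
  rw [intervalIntegral.integral_add hsum (by simp), intervalIntegral.integral_const,
    intervalIntegral.integral_const, intervalIntegral.integral_finsetSum (fun r _ => hsh r)] at hI
  have hJ : ∑ r ∈ Finset.range q, ∫ t in (0:ℝ)..(1 / q), g (x + r / q + t) =
      ∫ y in Set.Ico (0:ℝ) 1, g y := by
    have e1 : ∀ r ∈ Finset.range q, ∫ t in (0:ℝ)..(1 / q), g (x + r / q + t) =
        ∫ t in (x + (r : ℕ) / q)..(x + ((r + 1 : ℕ) : ℝ) / q), g t := by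
      intro r _
      rw [intervalIntegral.integral_comp_add_left (fun t => g t)]
      congr 1
      · ring
      · push_cast; ring
    rw [Finset.sum_congr rfl e1]
    rw [intervalIntegral.sum_integral_adjacent_intervals (a := fun r : ℕ => x + (r : ℝ) / q)
      (fun k _ => hbi _ _)]
    have e2 : x + (q : ℝ) / q = x + 1 := by field_simp
    rw [e2]
    simp only [Nat.cast_zero, zero_div, add_zero]
    rw [hper.intervalIntegral_add_eq x 0, zero_add, intervalIntegral.integral_of_le zero_le_one,
      integral_Ico_eq_integral_Ioo, integral_Ioc_eq_integral_Ioo]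
  rw [hJ] at hI
  simp only [sub_zero, smul_eq_mul] at hI
  have := mul_le_mul_of_nonneg_left hI hq'.le
  have e3 : (q : ℝ) * (1 / q * ∑ k ∈ K, g (x + k * α)) = ∑ k ∈ K, g (x + k * α) := by
    rw [← mul_assoc, mul_one_div_cancel hq'.ne', one_mul]
  rw [e3] at this
  refine this.trans (le_of_eq ?_)
  field_simp

/-! ### Bounded variation -/

lemma BVp.mono {β : Type*} [NormedAddCommGroup β] {g : ℝ → β} {W W' : ℝ} (h : BVp g W)
    (hW : W ≤ W') : BVp g W' := by
  obtain ⟨v, hv, hp⟩ := h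
  refine ⟨fun t => v t + (W' - W) * t, fun a b hab => ?_, fun t => ?_⟩
  · have := hv a b hab
    have h2 := mul_nonneg (sub_nonneg.2 hW) (sub_nonneg.2 hab)
    simp only
    linarith
  · simp only [hp]
    ring

lemma BVp.lip {β γ : Type*} [NormedAddCommGroup β] [NormedAddCommGroup γ]
    {g : ℝ → β} {h : ℝ → γ} {W : ℝ} (hg : BVp g W) (C : ℝ) (hC : 0 ≤ C)
    (hh : ∀ a b, ‖h b - h a‖ ≤ C * ‖g b - g a‖) : BVp h (C * W) := by
  obtain ⟨v, hv, hp⟩ := hg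
  refine ⟨fun t => C * v t, fun a b hab => ?_, fun t => ?_⟩
  · calc ‖h b - h a‖ ≤ C * ‖g b - g a‖ := hh a b
      _ ≤ C * (v b - v a) := mul_le_mul_of_nonneg_left (hv a b hab) hC
      _ = _ := by ring
  · simp only [hp]
    ring

lemma BVp.shift {β : Type*} [NormedAddCommGroup β] {g : ℝ → β} {W : ℝ} (h : BVp g W) (c : ℝ) :
    BVp (fun y => g (y + c)) W := by
  obtain ⟨v, hv, hp⟩ := h
  refine ⟨fun t => v (t + c), fun a b hab => hv _ _ (by linarith), fun t => ?_⟩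
  show v (t + 1 + c) = v (t + c) + W
  rw [← hp]
  ring_nf

lemma BVp.mul {β : Type*} [NormedRing β] {g h : ℝ → β} {W W' : ℝ} (hg : BVp g W)
    (hh : BVp h W') (C C' : ℝ) (hC : ∀ y, ‖g y‖ ≤ C) (hC' : ∀ y, ‖h y‖ ≤ C') :
    BVp (fun y => g y * h y) (C * W' + C' * W) := by
  obtain ⟨v, hv, hp⟩ := hg
  obtain ⟨w, hw, hp'⟩ := hh
  refine ⟨fun t => C * w t + C' * v t, fun a b hab => ?_, fun t => ?_⟩
  · have e : g b * h b - g a * h a = g b * (h b - h a) + (g b - g a) * h a := by noncomm_ring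
    rw [e]
    have hC0 : 0 ≤ C := (norm_nonneg _).trans (hC 0)
    have hC0' : 0 ≤ C' := (norm_nonneg _).trans (hC' 0)
    calc _ ≤ ‖g b * (h b - h a)‖ + ‖(g b - g a) * h a‖ := norm_add_le _ _
      _ ≤ ‖g b‖ * ‖h b - h a‖ + ‖g b - g a‖ * ‖h a‖ :=
        add_le_add (norm_mul_le _ _) (norm_mul_le _ _)
      _ ≤ C * (w b - w a) + (v b - v a) * C' := by
        have h1 := hv a b hab
        have h2 := hw a b hab
        have h3 : 0 ≤ v b - v a := (norm_nonneg _).trans h1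
        exact add_le_add (mul_le_mul (hC b) h2 (norm_nonneg _) hC0)
          (mul_le_mul h1 (hC' a) (norm_nonneg _) h3)
      _ = _ := by ring
  · simp only [hp, hp']
    ring

lemma BVp.zero {β : Type*} [NormedAddCommGroup β] (c : β) : BVp (fun _ : ℝ => c) 0 :=
  ⟨fun _ => 0, fun a b _ => by simp, fun t => by simp⟩

lemma BVp.add {β : Type*} [NormedAddCommGroup β] {g h : ℝ → β} {W W' : ℝ} (hg : BVp g W)
    (hh : BVp h W') : BVp (fun y => g y + h y) (W + W') := by
  obtain ⟨v, hv, hp⟩ := hg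
  obtain ⟨w, hw, hp'⟩ := hh
  refine ⟨fun t => v t + w t, fun a b hab => ?_, fun t => ?_⟩
  · have e : g b + h b - (g a + h a) = (g b - g a) + (h b - h a) := by abel
    rw [e]
    have h1 := hv a b hab
    have h2 := hw a b hab
    have := norm_add_le (g b - g a) (h b - h a)
    linarith
  · simp only [hp, hp']
    ring

lemma BVp.sum {ι : Type*} (s : Finset ι) (g : ι → ℝ → ℝ) (W : ℝ)
    (hg : ∀ i ∈ s, BVp (g i) W) : BVp (fun y => ∑ i ∈ s, g i y) (s.card * W) := by
  classical
  induction s using Finset.induction_on with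
  | empty => simpa using BVp.zero (0 : ℝ)
  | insert a s ha ih =>
    simp only [Finset.sum_insert ha, Finset.card_insert_of_notMem ha]
    have := (hg a (by simp)).add (ih fun i hi => hg i (by simp [hi]))
    refine this.mono (le_of_eq ?_)
    push_cast
    ring

lemma BVp_of_var (g : ℝ → ℝ) (hper : Function.Periodic g 1)
    (h : eVariationOn g (Set.Icc 0 1) ≠ ⊤) : BVp g (eVariationOn g (Set.Icc 0 1)).toReal := by
  set V : ℝ → ℝ := fun s => (eVariationOn g (Set.Icc 0 s)).toReal with hV
  have hfin : ∀ a b, 0 ≤ a → b ≤ 1 → eVariationOn g (Set.Icc a b) ≠ ⊤ := fun a b ha hb =>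
    ne_top_of_le_ne_top h (eVariationOn.mono g (Set.Icc_subset_Icc ha hb))
  have hloc : ∀ a b, 0 ≤ a → a ≤ b → b ≤ 1 → |g b - g a| ≤ V b - V a := by
    intro a b ha hab hb
    have e := eVariationOn.Icc_add_Icc g (s := Set.univ) ha hab (Set.mem_univ _)
    simp only [Set.univ_inter] at e
    have e2 : V a + (eVariationOn g (Set.Icc a b)).toReal = V b := by
      simp only [hV]
      rw [← ENNReal.toReal_add (hfin 0 a le_rfl (hab.trans hb)) (hfin a b ha hb), e]
    have e3 := eVariationOn.edist_le g (s := Set.Icc a b) (x := b) (y := a) ⟨hab, le_rfl⟩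
      ⟨le_rfl, hab⟩
    have e4 := ENNReal.toReal_mono (hfin a b ha hb) e3
    rw [← dist_edist, Real.dist_eq] at e4
    linarith
  have hV0 : V 0 = 0 := by
    simp only [hV, Set.Icc_self]
    rw [eVariationOn.subsingleton g Set.subsingleton_singleton]
    simp
  have hfr : ∀ y, g (Int.fract y) = g y := fun y => by
    have := hper.sub_zsmul_eq (x := y) ⌊y⌋
    rw [← this]
    congr 1
    rw [zsmul_eq_mul, mul_one]
    rfl
  have hg1 : g 1 = g 0 := by simpa using hper 0
  refine ⟨fun t => ⌊t⌋ * V 1 + V (Int.fract t), fun a b hab => ?_, fun t => ?_⟩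
  · rw [Real.norm_eq_abs, ← hfr a, ← hfr b]
    have fa := Int.fract_nonneg a
    have fb := Int.fract_nonneg b
    have fa1 := (Int.fract_lt_one a).le
    have fb1 := (Int.fract_lt_one b).le
    rcases (Int.floor_mono hab).eq_or_lt with he | hl
    · have : Int.fract a ≤ Int.fract b := by
        simp only [Int.fract, he]
        linarith
      have := hloc _ _ fa this fb1
      simp only [he]
      linarith
    · have h1 := hloc _ _ fa fa1 le_rfl
      have h2 := hloc _ _ le_rfl fb fb1
      rw [hV0] at h2
      rw [hg1] at h1
      have hl' : (⌊a⌋ : ℝ) + 1 ≤ ⌊b⌋ := by exact_mod_cast hl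
      have h3 : 0 ≤ V 1 := ENNReal.toReal_nonneg
      have h4 := mul_le_mul_of_nonneg_right hl' h3
      have h5 : |g (Int.fract b) - g (Int.fract a)| ≤ |g (Int.fract b) - g 0| +
        |g 0 - g (Int.fract a)| := abs_sub_le _ _ _
      simp only
      linarith
  · simp only [Int.floor_add_one, Int.fract_add_one, hV]
    push_cast
    ring

lemma trunc_per {f : ℝ → ℝ} (hper : Function.Periodic f 1) (B : ℝ) :
    Function.Periodic (trunc f B) 1 := fun x => by
  simp only [trunc, hper x]

lemma trunc_BV (f : ℝ → ℝ) (hper : Function.Periodic f 1) (hsv : sVar f ≠ ⊤) (B : ℝ)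
    (hB : 1 ≤ B) : BVp (trunc f B) ((sVar f).toReal * B) := by
  have hB0 : 0 < B := by linarith
  have h1 : (ENNReal.ofReal B)⁻¹ * pVar (trunc f B) ≤ sVar f :=
    le_iSup (fun B : {B : ℝ // 1 ≤ B} => (ENNReal.ofReal B.1)⁻¹ * pVar (trunc f B.1)) ⟨B, hB⟩
  have hne : ENNReal.ofReal B ≠ 0 := by simpa using hB0
  have h2 : pVar (trunc f B) ≤ sVar f * ENNReal.ofReal B := by
    have := mul_le_mul_left h1 (ENNReal.ofReal B)
    rwa [mul_comm (ENNReal.ofReal B)⁻¹, mul_assoc, ENNReal.inv_mul_cancel hne ENNReal.ofReal_ne_top,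
      mul_one] at this
  have h3 : sVar f * ENNReal.ofReal B ≠ ⊤ := ENNReal.mul_ne_top hsv ENNReal.ofReal_ne_top
  refine (BVp_of_var _ (trunc_per hper B) (ne_top_of_le_ne_top h3 h2)).mono ?_
  have := ENNReal.toReal_mono h3 h2
  rwa [ENNReal.toReal_mul, ENNReal.toReal_ofReal hB0.le] at this

lemma abs_trunc_le (f : ℝ → ℝ) (B : ℝ) (hB : 0 ≤ B) (y : ℝ) : |trunc f B y| ≤ B := by
  unfold trunc
  split_ifs with h
  · exact h
  · rw [abs_of_nonneg hB]

lemma abs_trunc_le' (f : ℝ → ℝ) (B : ℝ) (hB : 0 ≤ B) (y : ℝ) : |trunc f B y| ≤ |f y| := by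
  unfold trunc
  split_ifs with h
  · exact le_rfl
  · rw [abs_of_nonneg hB]
    exact (not_le.1 h).le

/-! ### Matrices -/

lemma norm_mat (a b c d : ℂ) :
    ‖(!![a, b; c, d] : Matrix (Fin 2) (Fin 2) ℂ)‖ = max (‖a‖ + ‖b‖) (‖c‖ + ‖d‖) := by
  rw [Matrix.linfty_opNorm_def]
  simp [Fin.univ_succ]

lemma norm_ge_one (M : Matrix (Fin 2) (Fin 2) ℂ) (h : M.det = 1) : 1 ≤ ‖M‖ := by
  rw [Matrix.eta_fin_two M] at h ⊢
  rw [norm_mat]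
  rw [Matrix.det_fin_two_of] at h
  set a := M 0 0
  set b := M 0 1
  set c := M 1 0
  set d := M 1 1
  have h1 : (1 : ℝ) ≤ ‖a‖ * ‖d‖ + ‖b‖ * ‖c‖ := by
    have := norm_sub_le (a * d) (b * c)
    rw [h, norm_mul, norm_mul, norm_one] at this
    exact this
  set T := max (‖a‖ + ‖b‖) (‖c‖ + ‖d‖)
  have h2 : ‖a‖ + ‖b‖ ≤ T := le_max_left _ _
  have h3 : ‖c‖ + ‖d‖ ≤ T := le_max_right _ _
  have h4 := norm_nonneg a
  have h5 := norm_nonneg b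
  have h6 := norm_nonneg c
  have h7 := norm_nonneg d
  by_contra! hT
  nlinarith [mul_le_mul h2 h3 (by linarith) (by linarith), mul_nonneg h4 h6, mul_nonneg h5 h7]

lemma norm_inv_le (M : Matrix (Fin 2) (Fin 2) ℂ) (h : M.det = 1) : ‖M⁻¹‖ ≤ 2 * ‖M‖ := by
  rw [Matrix.inv_def, h]
  simp only [Ring.inverse_one, one_smul]
  rw [Matrix.eta_fin_two M, Matrix.adjugate_fin_two_of, norm_mat, norm_mat, norm_neg, norm_neg]
  set a := ‖M 0 0‖
  set b := ‖M 0 1‖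
  set c := ‖M 1 0‖
  set d := ‖M 1 1‖
  have h2 : a + b ≤ max (a + b) (c + d) := le_max_left _ _
  have h3 : c + d ≤ max (a + b) (c + d) := le_max_right _ _
  have h4 : 0 ≤ a := norm_nonneg _
  have h5 : 0 ≤ b := norm_nonneg _
  have h6 : 0 ≤ c := norm_nonneg _
  have h7 : 0 ≤ d := norm_nonneg _
  apply max_le <;> linarith

lemma coc_zero (α : ℝ) (g : ℝ → ℝ) (E y : ℝ) : schCocycle α g E 0 y = 1 := by
  simp [schCocycle]

lemma coc_succ (α : ℝ) (g : ℝ → ℝ) (E : ℝ) (m : ℕ) (y : ℝ) :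
    schCocycle α g E (m + 1) y =
      !![((E : ℂ) - (g (y + m * α) : ℂ)), -1; 1, 0] * schCocycle α g E m y := by
  unfold schCocycle
  rw [List.range_succ_eq_map, List.map_cons, List.prod_cons, List.map_map]
  congr 2
  apply List.map_congr_left
  intro k _
  have : m + 1 - 1 - Nat.succ k = m - 1 - k := by omega
  simp only [Function.comp, this]

lemma coc_add (α : ℝ) (g : ℝ → ℝ) (E : ℝ) (m n : ℕ) (y : ℝ) :
    schCocycle α g E (n + m) y = schCocycle α g E m (y + n * α) * schCocycle α g E n y := by
  induction m with
  | zero => simp [coc_zero]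
  | succ m ih =>
    rw [← add_assoc, coc_succ, ih, coc_succ, Matrix.mul_assoc]
    congr 6
    push_cast
    ring_nf

lemma coc_det (α : ℝ) (g : ℝ → ℝ) (E : ℝ) (m : ℕ) (y : ℝ) : (schCocycle α g E m y).det = 1 := by
  induction m with
  | zero => simp [coc_zero]
  | succ m ih => rw [coc_succ, Matrix.det_mul, ih, Matrix.det_fin_two_of]; simp

lemma coc_ge (α : ℝ) (g : ℝ → ℝ) (E : ℝ) (m : ℕ) (y : ℝ) : 1 ≤ ‖schCocycle α g E m y‖ :=
  norm_ge_one _ (coc_det α g E m y)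

/-- log norm of the cocycle. -/
def lphi (α : ℝ) (g : ℝ → ℝ) (E : ℝ) (m : ℕ) (y : ℝ) : ℝ := Real.log ‖schCocycle α g E m y‖

lemma lphi_nonneg (α : ℝ) (g : ℝ → ℝ) (E : ℝ) (m : ℕ) (y : ℝ) : 0 ≤ lphi α g E m y :=
  Real.log_nonneg (coc_ge α g E m y)

lemma lphi_add (α : ℝ) (g : ℝ → ℝ) (E : ℝ) (m n : ℕ) (y : ℝ) :
    lphi α g E (n + m) y ≤ lphi α g E n y + lphi α g E m (y + n * α) := by
  unfold lphi
  have h1 := coc_ge α g E m (y + n * α)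
  have h2 := coc_ge α g E n y
  rw [← Real.log_mul (by linarith) (by linarith)]
  apply Real.log_le_log
  · linarith [coc_ge α g E (n + m) y]
  · rw [coc_add]
    exact (norm_mul_le _ _).trans (le_of_eq (mul_comm _ _))

lemma step_norm (E t : ℝ) :
    ‖(!![((E : ℂ) - (t : ℂ)), -1; 1, 0] : Matrix (Fin 2) (Fin 2) ℂ)‖ ≤ (1 + |E|) * (1 + |t|) := by
  rw [norm_mat]
  have : ‖(E : ℂ) - (t : ℂ)‖ = |E - t| := by
    rw [← Complex.ofReal_sub, Complex.norm_real, Real.norm_eq_abs]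
  rw [this]
  have h1 := abs_sub E t
  have h2 := mul_nonneg (abs_nonneg E) (abs_nonneg t)
  have h3 := abs_nonneg E
  have h4 := abs_nonneg t
  simp only [norm_neg, norm_one, norm_zero, add_zero]
  apply max_le <;> nlinarith

lemma lphi_one (α : ℝ) (g : ℝ → ℝ) (E : ℝ) (y : ℝ) :
    lphi α g E 1 y ≤ Real.log (1 + |E|) + Real.log (1 + |g y|) := by
  have h3 := abs_nonneg E
  have h4 := abs_nonneg (g y)
  have e := coc_succ α g E 0 y
  rw [coc_zero, mul_one, zero_add] at e
  rw [← Real.log_mul (by linarith) (by linarith)]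
  unfold lphi
  apply Real.log_le_log
  · linarith [coc_ge α g E 1 y]
  · rw [e]
    have := step_norm E (g y)
    simpa using this

lemma lphi_zero (α : ℝ) (g : ℝ → ℝ) (E : ℝ) (y : ℝ) : lphi α g E 0 y = 0 := by
  unfold lphi
  rw [coc_zero]
  have : ‖(1 : Matrix (Fin 2) (Fin 2) ℂ)‖ = 1 := by
    rw [Matrix.one_fin_two, norm_mat]
    simp
  rw [this, Real.log_one]

lemma lphi_le (α : ℝ) (g : ℝ → ℝ) (E : ℝ) (m : ℕ) (y : ℝ) :
    lphi α g E m y ≤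
      ∑ i ∈ Finset.range m, (Real.log (1 + |E|) + Real.log (1 + |g (y + i * α)|)) := by
  induction m with
  | zero => simp [lphi_zero]
  | succ m ih =>
    rw [Finset.sum_range_succ]
    have := lphi_add α g E 1 m y
    have h2 := lphi_one α g E (y + m * α)
    linarith

lemma coc_BV (α : ℝ) (g : ℝ → ℝ) (E : ℝ) (m : ℕ) (W B : ℝ) (hg : BVp g W)
    (hB : ∀ y, |g y| ≤ B) :
    (∃ W', BVp (schCocycle α g E m) W') ∧ ∃ C, ∀ y, ‖schCocycle α g E m y‖ ≤ C := by
  induction m with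
  | zero =>
    have e : schCocycle α g E 0 = fun _ => 1 := funext fun y => coc_zero α g E y
    rw [e]
    exact ⟨⟨0, BVp.zero _⟩, ⟨_, fun _ => le_rfl⟩⟩
  | succ m ih =>
    obtain ⟨⟨W', h1⟩, C, hC⟩ := ih
    have hs : ∀ y, ‖(!![((E : ℂ) - (g (y + m * α) : ℂ)), -1; 1, 0] :
        Matrix (Fin 2) (Fin 2) ℂ)‖ ≤ (1 + |E|) * (1 + B) := fun y =>
      (step_norm E _).trans (by have := hB (y + m * α); gcongr)
    have hb : BVp (fun y => (!![((E : ℂ) - (g (y + m * α) : ℂ)), -1; 1, 0] :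
        Matrix (Fin 2) (Fin 2) ℂ)) (1 * W) := by
      apply (hg.shift (m * α)).lip 1 zero_le_one
      intro a b
      have e : (!![((E : ℂ) - (g (b + m * α) : ℂ)), -1; 1, 0] : Matrix (Fin 2) (Fin 2) ℂ) -
          !![((E : ℂ) - (g (a + m * α) : ℂ)), -1; 1, 0] =
          !![((g (a + m * α) - g (b + m * α) : ℝ) : ℂ), 0; 0, 0] := by
        ext i j
        fin_cases i <;> fin_cases j <;> simp
      rw [e, norm_mat, Complex.norm_real, one_mul, norm_sub_rev]
      simp
    have e : schCocycle α g E (m + 1) = fun y =>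
      !![((E : ℂ) - (g (y + m * α) : ℂ)), -1; 1, 0] * schCocycle α g E m y :=
      funext fun y => coc_succ α g E m y
    rw [e]
    refine ⟨⟨_, hb.mul h1 _ _ hs hC⟩, (1 + |E|) * (1 + B) * C, fun y => ?_⟩
    refine (norm_mul_le _ _).trans ?_
    exact mul_le_mul (hs y) (hC y) (norm_nonneg _) ((norm_nonneg _).trans (hs y))

lemma lphi_BV (α : ℝ) (g : ℝ → ℝ) (E : ℝ) (m : ℕ) (W B : ℝ) (hg : BVp g W)
    (hB : ∀ y, |g y| ≤ B) : ∃ W', BVp (lphi α g E m) W' := by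
  obtain ⟨⟨W', h1⟩, -⟩ := coc_BV α g E m W B hg hB
  refine ⟨_, h1.lip 1 zero_le_one fun a b => ?_⟩
  have key : ∀ u w : ℝ, 1 ≤ u → 1 ≤ w → Real.log u - Real.log w ≤ |u - w| := by
    intro u w hu hw
    rcases le_total u w with h | h
    · have := Real.log_le_log (by linarith) h
      linarith [abs_nonneg (u - w)]
    · rw [← Real.log_div (by linarith) (by linarith)]
      have h2 := Real.log_le_sub_one_of_pos (show 0 < u / w by positivity)
      have h3 : u / w - 1 = (u - w) / w := by field_simp
      have h4 : (u - w) / w ≤ u - w := div_le_self (by linarith) hw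
      linarith [le_abs_self (u - w)]
  have hA := coc_ge α g E m a
  have hB' := coc_ge α g E m b
  rw [one_mul]
  refine le_trans ?_ (abs_norm_sub_norm_le _ _)
  rw [Real.norm_eq_abs, abs_le]
  unfold lphi
  have k1 := key _ _ hA hB'
  have k2 := key _ _ hB' hA
  rw [abs_sub_comm] at k1
  constructor <;> linarith

lemma lphi_per (α : ℝ) (g : ℝ → ℝ) (hg : Function.Periodic g 1) (E : ℝ) (m : ℕ) :
    Function.Periodic (lphi α g E m) 1 := by
  intro y
  unfold lphi
  congr 2
  induction m with
  | zero => simp [coc_zero]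
  | succ m ih =>
    rw [coc_succ, coc_succ, ih, ← hg (y + m * α)]
    congr 6
    ring_nf

lemma lphi_congr (α : ℝ) (g h : ℝ → ℝ) (E : ℝ) (m : ℕ) (y : ℝ)
    (hgh : ∀ i < m, g (y + i * α) = h (y + i * α)) : lphi α g E m y = lphi α h E m y := by
  unfold lphi
  congr 2
  induction m with
  | zero => simp [coc_zero]
  | succ m ih =>
    rw [coc_succ, coc_succ, ih (fun i hi => hgh i (by omega)), hgh m (by omega)]

/-- averaging lemma -/
lemma lphi_avg (α : ℝ) (g : ℝ → ℝ) (E : ℝ) (m N : ℕ) (y D : ℝ) (hD0 : 0 ≤ D)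
    (hD : ∀ i < N + m, lphi α g E 1 (y + i * α) ≤ D) :
    m * lphi α g E N y ≤ 2 * m ^ 2 * D + ∑ n ∈ Finset.range N, lphi α g E m (y + n * α) := by
  have hext : ∀ n j, n + j ≤ N + m → lphi α g E (n + j) y ≤ lphi α g E n y + j * D := by
    intro n j
    induction j with
    | zero => intro _; simp
    | succ j ih =>
      intro h
      have h1 := ih (by omega)
      have h2 := lphi_add α g E 1 (n + j) y
      have h3 := hD (n + j) (by omega)
      rw [← add_assoc]
      push_cast at h2 h3 ⊢
      linarith
  have hsh : ∀ j, j ≤ m → lphi α g E j y ≤ m * D := by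
    intro j hj
    have := hext 0 j (by omega)
    rw [lphi_zero, zero_add] at this
    have h2 : (j : ℝ) * D ≤ m * D := by gcongr
    rw [zero_add] at this
    linarith
  have hpos : 0 ≤ ∑ n ∈ Finset.range N, lphi α g E m (y + n * α) :=
    Finset.sum_nonneg fun n _ => lphi_nonneg _ _ _ _ _
  have hm0 : (0 : ℝ) ≤ m := by positivity
  rcases lt_or_ge N m with hN | hN
  · have := mul_le_mul_of_nonneg_left (hsh N hN.le) hm0
    have h2 : 0 ≤ (m : ℝ) ^ 2 * D := by positivity
    nlinarith
  · have hPhi : ∀ n, ∑ i ∈ Finset.range m, lphi α g E (n + i) y ≤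
        ∑ i ∈ Finset.range m, lphi α g E i y + ∑ k ∈ Finset.range n, lphi α g E m (y + k * α) := by
      intro n
      induction n with
      | zero => simp
      | succ n ih =>
        rw [Finset.sum_range_succ _ n]
        have e1 := Finset.sum_range_succ (fun i => lphi α g E (n + i) y) m
        have e2 := Finset.sum_range_succ' (fun i => lphi α g E (n + i) y) m
        have e3 : ∑ i ∈ Finset.range m, lphi α g E (n + 1 + i) y =
            ∑ i ∈ Finset.range m, lphi α g E (n + (i + 1)) y :=
          Finset.sum_congr rfl fun i _ => by congr 1; omega
        have h4 := lphi_add α g E m n y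
        rw [e3]
        rw [add_zero] at e2
        linarith
    obtain ⟨n, rfl⟩ := Nat.exists_eq_add_of_le hN
    have h1 := hPhi n
    have h2 : ∑ i ∈ Finset.range m, lphi α g E i y ≤ m * (m * D) := by
      have := Finset.sum_le_card_nsmul (Finset.range m) (fun i => lphi α g E i y) (m * D)
        (fun i hi => hsh i (Finset.mem_range.1 hi).le)
      simpa using this
    have h3 : m * lphi α g E (m + n) y - m * (m * D) ≤
        ∑ i ∈ Finset.range m, lphi α g E (n + i) y := by
      have := Finset.card_nsmul_le_sum (Finset.range m) (fun i => lphi α g E (n + i) y)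
        (lphi α g E (m + n) y - m * D) (fun i hi => by
          have hi' := Finset.mem_range.1 hi
          have := hext (n + i) (m - i) (by omega)
          have e : n + i + (m - i) = m + n := by omega
          rw [e] at this
          have h6 : ((m - i : ℕ) : ℝ) * D ≤ m * D := by
            gcongr
            omega
          linarith)
      simp only [Finset.card_range, nsmul_eq_mul] at this
      linarith
    have h5 : ∑ k ∈ Finset.range n, lphi α g E m (y + k * α) ≤
        ∑ k ∈ Finset.range (m + n), lphi α g E m (y + k * α) :=
      Finset.sum_le_sum_of_subset_of_nonneg (Finset.range_mono (by omega))
        (fun n _ _ => lphi_nonneg _ _ _ _ _)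
    nlinarith

lemma tProd_eq (α : ℝ) (f : ℝ → ℝ) (E x : ℝ) (k : ℤ) (m : ℕ) (n : ℤ) (hn : n = k + m) :
    tProd (fun m : ℤ => (f (x + m * α) : ℂ)) (E : ℂ) n k = schCocycle α f E m (x + k * α) := by
  subst hn
  unfold tProd schCocycle
  have e : (k + m - k : ℤ).toNat = m := by omega
  rw [e]
  simp only [List.pure_def, List.bind_eq_flatMap]
  rw [← List.map_eq_flatMap, List.map_map]
  congr 1
  apply List.map_congr_left
  intro j hj
  have hj' := List.mem_range.1 hj
  have e2 : ((m - 1 - j : ℕ) : ℝ) = (m : ℝ) - 1 - j := by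
    rw [Nat.cast_sub (by omega), Nat.cast_sub (by omega)]
    simp
  have e3 : x + ((k + m - 1 - j : ℤ) : ℝ) * α = x + k * α + ((m - 1 - j : ℕ) : ℝ) * α := by
    rw [e2]
    push_cast
    ring
  simp only [tMat, Function.comp]
  rw [e3]

/-! ### Dyadic level functions -/

/-- Dyadic cutoff function: equals `1` where `2 ^ i ≤ |f|`, and `0` where `|f| ≤ 2 ^ i / 2`. -/
def psi (f : ℝ → ℝ) (i : ℕ) (y : ℝ) : ℝ := max (2 / 2 ^ i * |trunc f (2 ^ i) y| - 1) 0

/-- Sum of dyadic cutoffs. -/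
def GG (f : ℝ → ℝ) (i0 I : ℕ) (y : ℝ) : ℝ := ∑ i ∈ Finset.Ico i0 I, psi f i y

lemma psi_nonneg (f : ℝ → ℝ) (i : ℕ) (y : ℝ) : 0 ≤ psi f i y := le_max_right _ _

lemma psi_le_one (f : ℝ → ℝ) (i : ℕ) (y : ℝ) : psi f i y ≤ 1 := by
  have hp : (0 : ℝ) < 2 ^ i := by positivity
  have h := abs_trunc_le f (2 ^ i) hp.le y
  apply max_le _ zero_le_one
  have : 2 / 2 ^ i * |trunc f (2 ^ i) y| ≤ 2 / 2 ^ i * 2 ^ i := by gcongr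
  have e : (2 : ℝ) / 2 ^ i * 2 ^ i = 2 := by field_simp
  linarith

lemma psi_eq_one (f : ℝ → ℝ) (i : ℕ) (y : ℝ) (h : 2 ^ i ≤ |f y|) : psi f i y = 1 := by
  have hp : (0 : ℝ) < 2 ^ i := by positivity
  have e : |trunc f (2 ^ i) y| = 2 ^ i := by
    unfold trunc
    split_ifs with h2
    · exact le_antisymm h2 h
    · rw [abs_of_pos hp]
  unfold psi
  rw [e]
  have e : (2 : ℝ) / 2 ^ i * 2 ^ i = 2 := by field_simp
  rw [e]
  norm_num

lemma psi_eq_zero (f : ℝ → ℝ) (i : ℕ) (y : ℝ) (h : 2 * |f y| ≤ 2 ^ i) : psi f i y = 0 := by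
  have hp : (0 : ℝ) < 2 ^ i := by positivity
  have h1 := abs_trunc_le' f (2 ^ i) hp.le y
  apply max_eq_right
  have : 2 / 2 ^ i * |trunc f (2 ^ i) y| ≤ 2 / 2 ^ i * |f y| := by gcongr
  have e : (2 : ℝ) / 2 ^ i * |f y| = 2 * |f y| / 2 ^ i := by ring
  have e2 : 2 * |f y| / 2 ^ i ≤ 1 := by rw [div_le_one hp]; exact h
  linarith

lemma psi_BV (f : ℝ → ℝ) (hper : Function.Periodic f 1) (hsv : sVar f ≠ ⊤) (i : ℕ) :
    BVp (psi f i) (2 * (sVar f).toReal) := by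
  have h := trunc_BV f hper hsv (2 ^ i) (one_le_pow₀ (by norm_num))
  have hp : (0 : ℝ) < 2 ^ i := by positivity
  have := h.lip (h := psi f i) (2 / 2 ^ i) (by positivity) (fun a b => by
    rw [Real.norm_eq_abs, Real.norm_eq_abs]
    unfold psi
    refine (abs_max_sub_max_le_abs _ _ _).trans ?_
    have e : 2 / 2 ^ i * |trunc f (2 ^ i) b| - 1 - (2 / 2 ^ i * |trunc f (2 ^ i) a| - 1) =
      2 / 2 ^ i * (|trunc f (2 ^ i) b| - |trunc f (2 ^ i) a|) := by ring
    rw [e, abs_mul, abs_of_pos (show (0 : ℝ) < 2 / 2 ^ i by positivity)]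
    exact mul_le_mul_of_nonneg_left
      (abs_abs_sub_abs_le (trunc f (2 ^ i) b) (trunc f (2 ^ i) a)) (by positivity))
  refine this.mono (le_of_eq ?_)
  field_simp

lemma GG_nonneg (f : ℝ → ℝ) (i0 I : ℕ) (y : ℝ) : 0 ≤ GG f i0 I y :=
  Finset.sum_nonneg fun _ _ => psi_nonneg _ _ _

lemma GG_BV (f : ℝ → ℝ) (hper : Function.Periodic f 1) (hsv : sVar f ≠ ⊤) (i0 I : ℕ) :
    BVp (GG f i0 I) (I * (2 * (sVar f).toReal)) := by
  have := BVp.sum (Finset.Ico i0 I) (psi f) _ (fun i _ => psi_BV f hper hsv i)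
  refine this.mono ?_
  rw [Nat.card_Ico]
  gcongr
  omega

lemma GG_per (f : ℝ → ℝ) (hper : Function.Periodic f 1) (i0 I : ℕ) :
    Function.Periodic (GG f i0 I) 1 := fun y => by
  unfold GG psi
  simp only [trunc_per hper _ y]

lemma GG_lower (f : ℝ → ℝ) (i0 I : ℕ) (y : ℝ) (h1 : 2 ^ (2 * i0) < |f y|) (h2 : |f y| < 2 ^ I) :
    Real.log (1 + |f y|) ≤ 2 * GG f i0 I y ∧ 1 ≤ GG f i0 I y := by
  have hone : 1 ≤ |f y| := (one_le_pow₀ (by norm_num)).trans h1.le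
  obtain ⟨n, hn1, hn2⟩ := exists_nat_pow_near hone (one_lt_two)
  have hn : 2 * i0 ≤ n := by
    have := (pow_lt_pow_iff_right₀ (one_lt_two (α := ℝ))).1 (h1.trans hn2)
    omega
  have hI : n < I := (pow_lt_pow_iff_right₀ (one_lt_two (α := ℝ))).1 (hn1.trans_lt h2)
  have hG : ((n + 1 - i0 : ℕ) : ℝ) ≤ GG f i0 I y := by
    have e : ((n + 1 - i0 : ℕ) : ℝ) = ∑ i ∈ Finset.Ico i0 (n + 1), psi f i y := by
      rw [Finset.sum_congr rfl (g := fun _ => (1 : ℝ))]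
      · simp
      · intro i hi
        apply psi_eq_one
        refine le_trans ?_ hn1
        have := (Finset.mem_Ico.1 hi).2
        exact pow_le_pow_right₀ (by norm_num) (by omega)
    rw [e]
    exact Finset.sum_le_sum_of_subset_of_nonneg
      (Finset.Ico_subset_Ico le_rfl (by omega)) (fun i _ _ => psi_nonneg f i y)
  rw [Nat.cast_sub (by omega)] at hG
  push_cast at hG
  have hn' : (2 : ℝ) * i0 ≤ n := by exact_mod_cast hn
  have hlog : Real.log (1 + |f y|) ≤ (n + 2) := by
    have h3 : 1 + |f y| ≤ 2 ^ (n + 2) := by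
      have : (1 : ℝ) ≤ 2 ^ (n + 1) := one_le_pow₀ (by norm_num)
      rw [pow_succ _ (n + 1)]
      linarith
    have := Real.log_le_log (by linarith) h3
    rw [Real.log_pow] at this
    push_cast at this
    have h4 := Real.log_two_lt_d9
    have h5 : ((n : ℝ) + 2) * Real.log 2 ≤ (n + 2) * 1 := by
      gcongr
      linarith
    linarith
  have hi0 : (0 : ℝ) ≤ i0 := by positivity
  constructor <;> linarith

/-- Tail majorant of `GG`. -/
def HH (f : ℝ → ℝ) (i0 : ℕ) (y : ℝ) : ℝ :=
  if 2 * |f y| ≤ 2 ^ i0 then 0 else 5 * Real.log (1 + |f y|)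

lemma log_nonneg' (t : ℝ) : 0 ≤ Real.log (1 + |t|) :=
  Real.log_nonneg (by linarith [abs_nonneg t])

lemma GG_upper (f : ℝ → ℝ) (i0 I : ℕ) (hi0 : 1 ≤ i0) (y : ℝ) : GG f i0 I y ≤ HH f i0 y := by
  unfold HH
  split_ifs with h
  · apply le_of_eq
    apply Finset.sum_eq_zero
    intro i hi
    apply psi_eq_zero
    exact h.trans (pow_le_pow_right₀ (by norm_num) (Finset.mem_Ico.1 hi).1)
  · push Not at h
    have h2 : (2 : ℝ) ^ 1 ≤ 2 ^ i0 := pow_le_pow_right₀ (by norm_num) hi0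
    rw [pow_one] at h2
    obtain ⟨n, hn1, hn2⟩ := exists_nat_pow_near (show (1 : ℝ) ≤ 2 * |f y| by linarith)
      (one_lt_two)
    have hG : GG f i0 I y ≤ n + 1 := by
      calc GG f i0 I y ≤ ∑ i ∈ Finset.Ico i0 I, if i ∈ Finset.range (n + 1) then (1 : ℝ) else 0 := by
            apply Finset.sum_le_sum
            intro i _
            split_ifs with hi
            · exact psi_le_one _ _ _
            · rw [Finset.mem_range, not_lt] at hi
              apply le_of_eq
              apply psi_eq_zero
              exact hn2.le.trans (pow_le_pow_right₀ (by norm_num) hi)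
        _ = ∑ i ∈ (Finset.Ico i0 I).filter (· ∈ Finset.range (n + 1)), (1 : ℝ) := by
            rw [Finset.sum_filter]
        _ ≤ ∑ i ∈ Finset.range (n + 1), (1 : ℝ) := by
            apply Finset.sum_le_sum_of_subset_of_nonneg
            · intro i hi
              exact (Finset.mem_filter.1 hi).2
            · intros; exact zero_le_one
        _ = n + 1 := by simp
    have l1 : Real.log 2 ≤ Real.log (1 + |f y|) := Real.log_le_log (by norm_num) (by linarith)
    have l2 : n * Real.log 2 ≤ Real.log 2 + Real.log (1 + |f y|) := by
      rw [← Real.log_pow, ← Real.log_mul (by norm_num) (by linarith)]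
      apply Real.log_le_log (by positivity)
      linarith
    have l3 := Real.log_two_gt_d9
    have hn0 : (0 : ℝ) ≤ n := by positivity
    nlinarith

/-! ### Comparison with the truncated cocycle -/

lemma lphi_compare (α : ℝ) (f : ℝ → ℝ) (E : ℝ) (m i0 I : ℕ) (y : ℝ)
    (hI : ∀ i < m, |f (y + i * α)| < 2 ^ I) :
    lphi α f E m y ≤ lphi α (trunc f (2 ^ (2 * i0))) E m y +
      m * (Real.log (1 + |E|) + 2) * ∑ i ∈ Finset.range m, GG f i0 I (y + i * α) := by
  set S := ∑ i ∈ Finset.range m, GG f i0 I (y + i * α) with hS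
  have hS0 : 0 ≤ S := Finset.sum_nonneg fun _ _ => GG_nonneg _ _ _ _
  have hc := log_nonneg' E
  by_cases hall : ∀ i < m, |f (y + i * α)| ≤ 2 ^ (2 * i0)
  · rw [lphi_congr α f (trunc f (2 ^ (2 * i0))) E m y]
    · have : 0 ≤ m * (Real.log (1 + |E|) + 2) * S := by positivity
      linarith
    · intro i hi
      simp [trunc, hall i hi]
  · push Not at hall
    obtain ⟨j, hj, hjb⟩ := hall
    have hGS : ∀ i < m, GG f i0 I (y + i * α) ≤ S := fun i hi =>
      Finset.single_le_sum (f := fun i : ℕ => GG f i0 I (y + i * α))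
        (fun _ _ => GG_nonneg _ _ _ _) (Finset.mem_range.2 hi)
    obtain ⟨g1, g2⟩ := GG_lower f i0 I _ hjb (hI j hj)
    have hjS := hGS j hj
    have hterm : ∀ i ∈ Finset.range m, Real.log (1 + |E|) + Real.log (1 + |f (y + i * α)|) ≤
        (Real.log (1 + |E|) + 2) * S := by
      intro i hi
      have hi' := Finset.mem_range.1 hi
      have h1 : Real.log (1 + |E|) * 1 ≤ Real.log (1 + |E|) * S := by
        gcongr
        linarith
      have h2 : Real.log (1 + |f (y + i * α)|) ≤ 2 * S := by
        rcases le_or_gt (|f (y + i * α)|) (2 ^ (2 * i0)) with h | h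
        · have : Real.log (1 + |f (y + i * α)|) ≤ Real.log (1 + |f (y + j * α)|) := by
            apply Real.log_le_log
            · linarith [abs_nonneg (f (y + i * α))]
            · linarith
          linarith
        · have := (GG_lower f i0 I _ h (hI i hi')).1
          linarith [hGS i hi']
      linarith
    have h3 := lphi_le α f E m y
    have h4 := Finset.sum_le_card_nsmul (Finset.range m) _ _ hterm
    simp only [Finset.card_range, nsmul_eq_mul] at h4
    have h5 := lphi_nonneg α (trunc f (2 ^ (2 * i0))) E m y
    linarith

/-! ### Measurability and integrals -/

lemma BVp.measurable {g : ℝ → ℝ} {W : ℝ} (h : BVp g W) : Measurable g := by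
  obtain ⟨v, hv, hp⟩ := h
  have m1 : Monotone v := fun x y hxy => by
    have := hv x y hxy
    linarith [norm_nonneg (g y - g x)]
  have m2 : Monotone (fun x => g x + v x) := fun x y hxy => by
    have := hv x y hxy
    rw [Real.norm_eq_abs] at this
    have := (abs_le.1 this).1
    show g x + v x ≤ g y + v y
    linarith
  have := m2.measurable.sub m1.measurable
  have e : ((fun x => g x + v x) - v) = g := by
    ext x
    simp
  rwa [e] at this

lemma pow_large (t : ℝ) : ∀ᶠ n : ℕ in atTop, t ≤ (2 : ℝ) ^ n :=
  (tendsto_pow_atTop_atTop_of_one_lt (one_lt_two (α := ℝ))).eventually_ge_atTop t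

lemma f_measurable (f : ℝ → ℝ) (hper : Function.Periodic f 1) (hsv : sVar f ≠ ⊤) :
    Measurable f := by
  apply measurable_of_tendsto_metrizable (f := fun n : ℕ => trunc f (2 ^ n))
  · intro n
    exact (trunc_BV f hper hsv _ (one_le_pow₀ (by norm_num))).measurable
  · rw [tendsto_pi_nhds]
    intro y
    apply tendsto_const_nhds.congr'
    filter_upwards [pow_large |f y|] with n hn
    simp [trunc, hn]

lemma logF_intervalIntegrable (f : ℝ → ℝ) (hper : Function.Periodic f 1)
    (hlog : IntegrableOn (fun x => Real.log (1 + |f x|)) (Set.Ico 0 1) volume) (a b : ℝ) :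
    IntervalIntegrable (fun x => Real.log (1 + |f x|)) volume a b := by
  have hp : Function.Periodic (fun x => Real.log (1 + |f x|)) 1 := fun x => by simp only [hper x]
  apply hp.intervalIntegrable₀ one_ne_zero
  rw [intervalIntegrable_iff_integrableOn_Ico_of_le zero_le_one]
  exact hlog

lemma logF_shift (f : ℝ → ℝ) (hper : Function.Periodic f 1)
    (hlog : IntegrableOn (fun x => Real.log (1 + |f x|)) (Set.Ico 0 1) volume) (c : ℝ) :
    IntegrableOn (fun x => Real.log (1 + |f (x + c)|)) (Set.Ico 0 1) volume := by
  have := (logF_intervalIntegrable f hper hlog (0 + c) (1 + c)).comp_add_right c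
  simp only [add_sub_cancel_right] at this
  rwa [intervalIntegrable_iff_integrableOn_Ico_of_le zero_le_one] at this

lemma lphi_tendsto (α : ℝ) (f : ℝ → ℝ) (hper : Function.Periodic f 1) (hsv : sVar f ≠ ⊤)
    (hlog : IntegrableOn (fun x => Real.log (1 + |f x|)) (Set.Ico 0 1) volume) (E : ℝ) (m : ℕ) :
    Tendsto (fun i : ℕ => ∫ y in Set.Ico (0:ℝ) 1, lphi α (trunc f (2 ^ (2 * i))) E m y) atTop
      (nhds (∫ y in Set.Ico (0:ℝ) 1, lphi α f E m y)) := by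
  apply tendsto_integral_of_dominated_convergence
    (fun y => ∑ i ∈ Finset.range m, (Real.log (1 + |E|) + Real.log (1 + |f (y + i * α)|)))
  · intro n
    obtain ⟨W', h⟩ := lphi_BV α (trunc f (2 ^ (2 * n))) E m _ (2 ^ (2 * n))
      (trunc_BV f hper hsv _ (one_le_pow₀ (by norm_num)))
      (fun y => abs_trunc_le f _ (by positivity) y)
    exact h.measurable.aestronglyMeasurable
  · apply integrable_finsetSum
    intro i _
    apply Integrable.add
    · exact integrable_const _
    · exact logF_shift f hper hlog _
  · intro n
    apply Eventually.of_forall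
    intro y
    rw [Real.norm_eq_abs, abs_of_nonneg (lphi_nonneg _ _ _ _ _)]
    refine (lphi_le _ _ _ _ _).trans ?_
    apply Finset.sum_le_sum
    intro i _
    have := abs_trunc_le' f (2 ^ (2 * n)) (by positivity) (y + i * α)
    have h2 := abs_nonneg (trunc f (2 ^ (2 * n)) (y + i * α))
    gcongr
  · apply Eventually.of_forall
    intro y
    apply tendsto_const_nhds.congr'
    have : ∀ᶠ n : ℕ in atTop, ∀ i ∈ Finset.range m, |f (y + i * α)| ≤ 2 ^ n := by
      rw [Finset.eventually_all]
      intro i _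
      exact pow_large _
    filter_upwards [this] with n hn
    apply lphi_congr
    intro i hi
    have h1 := hn i (Finset.mem_range.2 hi)
    have h2 : (2 : ℝ) ^ n ≤ 2 ^ (2 * n) := pow_le_pow_right₀ (by norm_num) (by omega)
    simp [trunc, h1.trans h2]

lemma HH_integrable (f : ℝ → ℝ) (hper : Function.Periodic f 1) (hsv : sVar f ≠ ⊤)
    (hlog : IntegrableOn (fun x => Real.log (1 + |f x|)) (Set.Ico 0 1) volume) (i0 : ℕ) :
    IntegrableOn (HH f i0) (Set.Ico 0 1) volume ∧ Measurable (HH f i0) := by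
  have hm := f_measurable f hper hsv
  have hmH : Measurable (HH f i0) := by
    apply Measurable.ite
    · exact measurableSet_le (by fun_prop) measurable_const
    · exact measurable_const
    · have : Measurable fun y => |f y| := by fun_prop
      fun_prop
  refine ⟨?_, hmH⟩
  apply Integrable.mono' (hlog.const_mul 5) hmH.aestronglyMeasurable
  apply Eventually.of_forall
  intro y
  have := log_nonneg' (f y)
  unfold HH
  split_ifs
  · simp only [norm_zero]; linarith
  · rw [Real.norm_eq_abs, abs_of_nonneg (by linarith)]

lemma HH_tendsto (f : ℝ → ℝ) (hper : Function.Periodic f 1) (hsv : sVar f ≠ ⊤)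
    (hlog : IntegrableOn (fun x => Real.log (1 + |f x|)) (Set.Ico 0 1) volume) :
    Tendsto (fun i : ℕ => ∫ y in Set.Ico (0:ℝ) 1, HH f i y) atTop (nhds 0) := by
  have key : Tendsto (fun i : ℕ => ∫ y in Set.Ico (0:ℝ) 1, HH f i y) atTop
      (nhds (∫ y in Set.Ico (0:ℝ) 1, (0 : ℝ))) := by
    apply tendsto_integral_of_dominated_convergence (fun y => 5 * Real.log (1 + |f y|))
    · intro n
      exact (HH_integrable f hper hsv hlog n).2.aestronglyMeasurable
    · exact hlog.const_mul 5
    · intro n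
      apply Eventually.of_forall
      intro y
      have := log_nonneg' (f y)
      unfold HH
      split_ifs
      · simp only [norm_zero]; linarith
      · rw [Real.norm_eq_abs, abs_of_nonneg (by linarith)]
    · apply Eventually.of_forall
      intro y
      apply tendsto_const_nhds.congr'
      filter_upwards [pow_large (2 * |f y|)] with n hn
      simp [HH, hn]
  simpa using key

/-! ### Sublinear growth along orbits -/

lemma measure_shift (A : Set ℝ) (hA : MeasurableSet A) (hp : ∀ x, x + 1 ∈ A ↔ x ∈ A) (c : ℝ) :
    (volume.restrict (Set.Ico (0:ℝ) 1)) {x | x + c ∈ A} = (volume.restrict (Set.Ico (0:ℝ) 1)) A := by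
  have hAc : MeasurableSet {x | x + c ∈ A} := (measurable_add_const c) hA
  have hP : Function.Periodic (A.indicator (1 : ℝ → ℝ)) 1 := by
    intro x
    by_cases h : x ∈ A
    · rw [Set.indicator_of_mem h, Set.indicator_of_mem ((hp x).2 h)]; rfl
    · rw [Set.indicator_of_notMem h, Set.indicator_of_notMem (fun h' => h ((hp x).1 h'))]
  rw [← ENNReal.toReal_eq_toReal_iff' (measure_ne_top _ _) (measure_ne_top _ _)]
  change (volume.restrict (Set.Ico (0:ℝ) 1)).real _ = (volume.restrict (Set.Ico (0:ℝ) 1)).real _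
  rw [← integral_indicator_one hA, ← integral_indicator_one hAc]
  have conv : ∀ h : ℝ → ℝ, ∫ y in Set.Ico (0:ℝ) 1, h y = ∫ y in (0:ℝ)..1, h y := fun h => by
    rw [intervalIntegral.integral_of_le zero_le_one, integral_Ico_eq_integral_Ioo,
      integral_Ioc_eq_integral_Ioo]
  rw [conv, conv]
  have e : ∀ y, Set.indicator {x | x + c ∈ A} (1 : ℝ → ℝ) y = A.indicator (1 : ℝ → ℝ) (y + c) :=
    fun y => rfl
  simp only [e]
  rw [intervalIntegral.integral_comp_add_right (fun y => A.indicator (1 : ℝ → ℝ) y)]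
  have := hP.intervalIntegral_add_eq c 0
  rw [zero_add] at this ⊢
  rw [← this, add_comm]

lemma ae_sublinear (f : ℝ → ℝ) (hper : Function.Periodic f 1) (hm : Measurable f)
    (hlog : IntegrableOn (fun x => Real.log (1 + |f x|)) (Set.Ico 0 1) volume) (β δ : ℝ)
    (hδ : 0 < δ) :
    ∀ᵐ x ∂(volume.restrict (Set.Ico (0:ℝ) 1)), ∀ᶠ k : ℕ in atTop,
      Real.log (1 + |f (x + k * β)|) ≤ δ * k := by
  have hmu : IsProbabilityMeasure (volume.restrict (Set.Ico (0:ℝ) 1)) := ⟨by simp⟩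
  have hlm : Measurable fun x => Real.log (1 + |f x|) := by
    have : Measurable fun y => |f y| := by fun_prop
    fun_prop
  have h1 := @ProbabilityTheory.tsum_prob_mem_Ioi_lt_top ℝ
    { toMeasurableSpace := inferInstance, volume := volume.restrict (Set.Ico (0:ℝ) 1) } hmu
    (fun x => Real.log (1 + |f x|) / δ) (hlog.div_const δ)
    (fun x => div_nonneg (log_nonneg' _) hδ.le)
  have h2 : ∑' j : ℕ, (volume.restrict (Set.Ico (0:ℝ) 1))
      {x | x + j * β ∈ {x | Real.log (1 + |f x|) / δ ∈ Set.Ioi (j : ℝ)}} ≠ ⊤ := by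
    have e : ∀ j : ℕ, (volume.restrict (Set.Ico (0:ℝ) 1))
      {x | x + j * β ∈ {x | Real.log (1 + |f x|) / δ ∈ Set.Ioi (j : ℝ)}} =
      (volume.restrict (Set.Ico (0:ℝ) 1)) {x | Real.log (1 + |f x|) / δ ∈ Set.Ioi (j : ℝ)} := by
      intro j
      apply measure_shift
      · exact (hlm.div_const δ) measurableSet_Ioi
      · intro x
        simp only [Set.mem_setOf_eq, hper x]
    simp only [e]
    exact h1.ne
  filter_upwards [ae_eventually_notMem h2] with x hx
  filter_upwards [hx] with k hk
  simp only [Set.mem_Ioi, not_lt] at hk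
  rw [div_le_iff₀ hδ] at hk
  linarith

/-- The orbit of `x` has sublinear `log F`. -/
def GoodX (α : ℝ) (f : ℝ → ℝ) (x : ℝ) : Prop :=
  ∀ δ : ℝ, 0 < δ → ∃ Q : ℕ, ∀ q : ℕ, Q ≤ q → ∀ k : ℤ, |k| ≤ 3 * q →
    Real.log (1 + |f (x + k * α)|) ≤ δ * q

lemma sublinear_max (u : ℕ → ℝ) (h : ∀ n : ℕ, ∀ᶠ k : ℕ in atTop, u k ≤ 1 / ((n : ℝ) + 1) * k)
    (δ : ℝ) (hδ : 0 < δ) : ∃ Q : ℕ, ∀ q : ℕ, Q ≤ q → ∀ k : ℕ, k ≤ 3 * q → u k ≤ δ * q := by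
  obtain ⟨n, hn⟩ := exists_nat_one_div_lt (show 0 < δ / 3 by positivity)
  obtain ⟨k0, hk0⟩ := eventually_atTop.1 (h n)
  obtain ⟨M, hM⟩ := ((Set.finite_Iio k0).image u).bddAbove
  obtain ⟨Q, hQ⟩ := exists_nat_ge (M / δ)
  refine ⟨Q, fun q hq k hk => ?_⟩
  have hq' : (Q : ℝ) ≤ q := by exact_mod_cast hq
  rcases lt_or_ge k k0 with h1 | h1
  · have h2 : u k ≤ M := hM ⟨k, h1, rfl⟩
    rw [div_le_iff₀ hδ] at hQ
    nlinarith
  · have h2 := hk0 k h1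
    have hk' : (k : ℝ) ≤ 3 * q := by exact_mod_cast hk
    have h3 : 1 / ((n : ℝ) + 1) * k ≤ δ / 3 * (3 * q) := by gcongr
    linarith

lemma ae_good (α : ℝ) (f : ℝ → ℝ) (hper : Function.Periodic f 1) (hm : Measurable f)
    (hlog : IntegrableOn (fun x => Real.log (1 + |f x|)) (Set.Ico 0 1) volume) :
    ∀ᵐ x ∂(volume.restrict (Set.Ico (0:ℝ) 1)), GoodX α f x := by
  have h1 : ∀ᵐ x ∂(volume.restrict (Set.Ico (0:ℝ) 1)), ∀ n : ℕ, ∀ᶠ k : ℕ in atTop,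
      Real.log (1 + |f (x + k * α)|) ≤ 1 / ((n : ℝ) + 1) * k :=
    ae_all_iff.2 fun n => ae_sublinear f hper hm hlog α _ (by positivity)
  have h2 : ∀ᵐ x ∂(volume.restrict (Set.Ico (0:ℝ) 1)), ∀ n : ℕ, ∀ᶠ k : ℕ in atTop,
      Real.log (1 + |f (x + k * (-α))|) ≤ 1 / ((n : ℝ) + 1) * k :=
    ae_all_iff.2 fun n => ae_sublinear f hper hm hlog (-α) _ (by positivity)
  filter_upwards [h1, h2] with x hx1 hx2
  intro δ hδ
  obtain ⟨Q1, hQ1⟩ := sublinear_max _ hx1 δ hδ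
  obtain ⟨Q2, hQ2⟩ := sublinear_max _ hx2 δ hδ
  refine ⟨max Q1 Q2, fun q hq k hk => ?_⟩
  rcases le_total 0 k with h | h
  · obtain ⟨n, rfl⟩ := Int.eq_ofNat_of_zero_le h
    have := hQ1 q ((le_max_left _ _).trans hq) n (by
      rw [abs_of_nonneg h] at hk
      exact_mod_cast hk)
    simpa using this
  · obtain ⟨n, hn⟩ := Int.eq_ofNat_of_zero_le (neg_nonneg.2 h)
    have e : k = -(n : ℤ) := by omega
    subst e
    have := hQ2 q ((le_max_right _ _).trans hq) n (by
      rw [abs_neg, abs_of_nonneg (by omega)] at hk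
      exact_mod_cast hk)
    simpa using this

/-! ### Assembly -/

lemma core (α : ℝ) (f : ℝ → ℝ) (hper : Function.Periodic f 1) (hsv : sVar f ≠ ⊤)
    (hlog : IntegrableOn (fun x => Real.log (1 + |f x|)) (Set.Ico 0 1) volume) (E : ℝ)
    (m i0 I : ℕ) (hi0 : 1 ≤ i0) (W : ℝ) (hW : BVp (lphi α (trunc f (2 ^ (2 * i0))) E m) W)
    (q : ℕ) (hq : 0 < q) (hmq : m ≤ q) (p : ℤ) (hcop : IsCoprime p (q : ℤ))
    (happ : |α * q - p| * q ≤ 1) (K : Finset ℤ) (hK : ∀ k ∈ K, |k| ≤ 2 * q)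
    (hinj : ∀ k ∈ K, ∀ l ∈ K, (q : ℤ) ∣ k - l → k = l) (x : ℝ)
    (hF : ∀ k : ℤ, |k| ≤ 3 * q → |f (x + k * α)| < 2 ^ I) :
    ∑ k ∈ K, lphi α f E m (x + k * α) ≤
      q * (∫ y in Set.Ico (0:ℝ) 1, lphi α (trunc f (2 ^ (2 * i0))) E m y) + 4 * W +
      m * (Real.log (1 + |E|) + 2) * (m * (q * (∫ y in Set.Ico (0:ℝ) 1, HH f i0 y) +
        4 * (I * (2 * (sVar f).toReal)))) := by
  have hc := log_nonneg' E
  have h1 : ∀ k ∈ K, lphi α f E m (x + k * α) ≤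
      lphi α (trunc f (2 ^ (2 * i0))) E m (x + k * α) +
      m * (Real.log (1 + |E|) + 2) *
        ∑ i ∈ Finset.range m, GG f i0 I ((x + i * α) + k * α) := by
    intro k hk
    have := lphi_compare α f E m i0 I (x + k * α) (fun i hi => by
      have e : x + k * α + i * α = x + ((k + i : ℤ) : ℝ) * α := by push_cast; ring
      rw [e]
      apply hF
      have := abs_le.1 (hK k hk)
      rw [abs_le]
      constructor <;> omega)
    refine this.trans (le_of_eq ?_)
    congr 2
    apply Finset.sum_congr rfl
    intro i _
    congr 1
    ring
  have h2 := denjoy_koksma (lphi α (trunc f (2 ^ (2 * i0))) E m) (fun y => lphi_nonneg _ _ _ _ _)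
    (lphi_per α _ (trunc_per hper _) E m) W hW α q hq p hcop happ K hK hinj x
  have hGH : (∫ y in Set.Ico (0:ℝ) 1, GG f i0 I y) ≤ ∫ y in Set.Ico (0:ℝ) 1, HH f i0 y := by
    apply integral_mono (GG_BV f hper hsv i0 I).integrableOn (HH_integrable f hper hsv hlog i0).1
    intro y
    exact GG_upper f i0 I hi0 y
  have h3 : ∀ i ∈ Finset.range m, ∑ k ∈ K, GG f i0 I ((x + i * α) + k * α) ≤
      q * (∫ y in Set.Ico (0:ℝ) 1, HH f i0 y) + 4 * (I * (2 * (sVar f).toReal)) := by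
    intro i _
    have := denjoy_koksma (GG f i0 I) (GG_nonneg f i0 I) (GG_per f hper i0 I) _
      (GG_BV f hper hsv i0 I) α q hq p hcop happ K hK hinj (x + i * α)
    refine this.trans ?_
    gcongr
  have h4 := Finset.sum_le_card_nsmul (Finset.range m) _ _ h3
  simp only [Finset.card_range, nsmul_eq_mul] at h4
  rw [Finset.sum_comm] at h4
  have h5 := Finset.sum_le_sum h1
  rw [Finset.sum_add_distrib, ← Finset.mul_sum] at h5
  have h6 := mul_le_mul_of_nonneg_left h4
    (show 0 ≤ m * (Real.log (1 + |E|) + 2) by positivity)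
  linarith

lemma sum_Ico_int (h : ℤ → ℝ) (k : ℤ) (N : ℕ) :
    ∑ j ∈ Finset.Ico k (k + N), h j = ∑ n ∈ Finset.range N, h (k + n) := by
  symm
  apply Finset.sum_nbij (fun n : ℕ => k + n)
  · intro n hn
    rw [Finset.mem_range] at hn
    rw [Finset.mem_Ico]
    omega
  · intro a _ b _ hab
    simp only at hab
    omega
  · intro j hj
    simp only [Finset.coe_Ico, Set.mem_Ico] at hj
    refine ⟨(j - k).toNat, ?_, ?_⟩
    · simp only [Finset.coe_range, Set.mem_Iio]
      omega
    · simp only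
      omega
  · intros; rfl

lemma dvd_small (q : ℕ) (a : ℤ) (h : (q : ℤ) ∣ a) (h1 : -(q : ℤ) < a) (h2 : a < q) : a = 0 :=
  Int.eq_zero_of_abs_lt_dvd h (abs_lt.2 ⟨h1, h2⟩)

set_option maxHeartbeats 1000000 in
lemma two_seg (α : ℝ) (f : ℝ → ℝ) (hper : Function.Periodic f 1) (hsv : sVar f ≠ ⊤)
    (hlog : IntegrableOn (fun x => Real.log (1 + |f x|)) (Set.Ico 0 1) volume) (E L ε : ℝ)
    (hε : 0 < ε) (x : ℝ) (hx : GoodX α f x)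
    (hL : Tendsto
      (fun m : ℕ => (1 / m : ℝ) * ∫ x in Set.Ico (0:ℝ) 1, Real.log ‖schCocycle α f E m x‖)
      atTop (nhds L)) :
    ∃ Q : ℕ, ∀ q : ℕ, Q ≤ q → 0 < q → ∀ p : ℤ, IsCoprime p (q : ℤ) → |α * q - p| * q ≤ 1 →
      ∀ (k1 : ℤ) (N1 : ℕ) (k2 : ℤ) (N2 : ℕ), N1 ≤ q → N2 ≤ q →
      -2 * (q : ℤ) ≤ k1 → k1 + N1 ≤ 2 * q → -2 * (q : ℤ) ≤ k2 → k2 + N2 ≤ 2 * q →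
      (∀ a b : ℤ, k1 ≤ a → a < k1 + N1 → k2 ≤ b → b < k2 + N2 → ¬ (q : ℤ) ∣ a - b) →
      lphi α f E N1 (x + k1 * α) + lphi α f E N2 (x + k2 * α) ≤ (L + ε / 2) * q := by
  set c := Real.log (1 + |E|) with hcdef
  have hc : 0 ≤ c := log_nonneg' E
  set V := (sVar f).toReal with hV
  have hV0 : 0 ≤ V := ENNReal.toReal_nonneg
  -- choose m
  obtain ⟨m, hm1, hm2⟩ := ((hL.eventually_le_const (show L < L + ε / 16 by linarith)).and
    (eventually_ge_atTop 1)).exists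
  have hm0 : (1 : ℝ) ≤ m := by exact_mod_cast hm2
  set J := ∫ y in Set.Ico (0:ℝ) 1, lphi α f E m y with hJ
  have hJle : J ≤ m * (L + ε / 16) := by
    have e : (1 / m : ℝ) * J ≤ L + ε / 16 := hm1
    rw [one_div, inv_mul_le_iff₀ (by linarith)] at e
    exact e
  set C := m * (c + 2) with hC
  have hC0 : 0 ≤ C := by positivity
  -- choose i0
  have ev1 := (lphi_tendsto α f hper hsv hlog E m).eventually_le_const
    (show J < J + m * (ε / 16) by nlinarith)
  have ev2 := ((HH_tendsto f hper hsv hlog).const_mul C).eventually_le_const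
    (show C * 0 < ε / 16 by rw [mul_zero]; positivity)
  obtain ⟨i0, ⟨hA, hH⟩, hi0⟩ := ((ev1.and ev2).and (eventually_ge_atTop 1)).exists
  set A := ∫ y in Set.Ico (0:ℝ) 1, lphi α (trunc f (2 ^ (2 * i0))) E m y with hAdef
  set H := ∫ y in Set.Ico (0:ℝ) 1, HH f i0 y with hHdef
  obtain ⟨W, hW⟩ := lphi_BV α (trunc f (2 ^ (2 * i0))) E m _ (2 ^ (2 * i0))
      (trunc_BV f hper hsv _ (one_le_pow₀ (by norm_num)))
      (fun y => abs_trunc_le f _ (by positivity) y)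
  have hW0 := hW.nonneg
  set T := 16 * V * C + 4 * m + 1 with hT
  have hT0 : 0 < T := by positivity
  set δ := ε / (16 * T) with hδ
  have hδ0 : 0 < δ := by positivity
  have hδT : δ * T = ε / 16 := by rw [hδ]; field_simp
  obtain ⟨Q1, hQ1⟩ := hx δ hδ0
  set R := 4 * m ^ 2 * c + 4 * W + 16 * C * m * V with hR
  have hR0 : 0 ≤ R := by positivity
  obtain ⟨Q2, hQ2⟩ := exists_nat_ge (4 * R / ε)
  refine ⟨max m (max Q1 Q2), ?_⟩
  intro q hqQ hq p hcop happ k1 N1 k2 N2 hN1 hN2 h1 h2 h3 h4 hdist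
  have hmq : m ≤ q := (le_max_left _ _).trans hqQ
  have hqQ1 : Q1 ≤ q := ((le_max_left _ _).trans (le_max_right _ _)).trans hqQ
  have hqQ2 : (Q2 : ℝ) ≤ q := by
    exact_mod_cast ((le_max_right _ _).trans (le_max_right _ _)).trans hqQ
  have hq0 : (0 : ℝ) < q := by exact_mod_cast hq
  have hRq : 4 * R ≤ ε * q := by
    rw [div_le_iff₀ hε] at hQ2
    nlinarith
  have hg := hQ1 q hqQ1
  set I := ⌈2 * (δ * q)⌉₊ + 1 with hI
  have hIle : (I : ℝ) ≤ 2 * (δ * q) + 2 := by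
    have := (Nat.ceil_lt_add_one (show 0 ≤ 2 * (δ * q) by positivity)).le
    rw [hI]
    push_cast
    linarith
  have hIge : 2 * (δ * q) ≤ I := by
    have := Nat.le_ceil (2 * (δ * q))
    rw [hI]
    push_cast
    linarith
  have hF : ∀ k : ℤ, |k| ≤ 3 * q → |f (x + k * α)| < 2 ^ I := by
    intro k hk
    have h := hg k hk
    have hpos := abs_nonneg (f (x + k * α))
    have h5 : Real.log (1 + |f (x + k * α)|) ≤ Real.log (2 ^ I) := by
      rw [Real.log_pow]
      have := Real.log_two_gt_d9
      nlinarith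
    rw [Real.log_le_log_iff (by linarith) (by positivity)] at h5
    linarith
  set D := c + δ * q with hD
  have hD0 : 0 ≤ D := by positivity
  have avg : ∀ (k : ℤ) (N : ℕ), -2 * (q : ℤ) ≤ k → k + N ≤ 2 * q →
      m * lphi α f E N (x + k * α) ≤
        2 * m ^ 2 * D + ∑ j ∈ Finset.Ico k (k + N), lphi α f E m (x + j * α) := by
    intro k N hk1 hk2
    have := lphi_avg α f E m N (x + k * α) D hD0 (fun i hi => by
      refine (lphi_one _ _ _ _).trans ?_
      have e : x + k * α + i * α = x + ((k + i : ℤ) : ℝ) * α := by push_cast; ring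
      rw [e]
      have := hg (k + i) (by rw [abs_le]; constructor <;> omega)
      linarith)
    rw [sum_Ico_int (fun j => lphi α f E m (x + j * α))]
    refine this.trans (le_of_eq ?_)
    congr 1
    apply Finset.sum_congr rfl
    intro i _
    congr 1
    push_cast
    ring
  have a1 := avg k1 N1 h1 h2
  have a2 := avg k2 N2 h3 h4
  have hdisj : Disjoint (Finset.Ico k1 (k1 + N1)) (Finset.Ico k2 (k2 + N2)) := by
    rw [Finset.disjoint_left]
    intro a ha hb
    rw [Finset.mem_Ico] at ha hb
    exact hdist a a ha.1 ha.2 hb.1 hb.2 (by simp)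
  have hcore := core α f hper hsv hlog E m i0 I hi0 W hW q hq hmq p hcop happ
    (Finset.Ico k1 (k1 + N1) ∪ Finset.Ico k2 (k2 + N2))
    (by
      intro k hk
      rw [Finset.mem_union, Finset.mem_Ico, Finset.mem_Ico] at hk
      rw [abs_le]
      constructor <;> omega)
    (by
      intro k hk l hl hkl
      rw [Finset.mem_union, Finset.mem_Ico, Finset.mem_Ico] at hk hl
      rcases hk with hk | hk <;> rcases hl with hl | hl
      · have := dvd_small q (k - l) hkl (by omega) (by omega)
        omega
      · exact absurd hkl (hdist k l hk.1 hk.2 hl.1 hl.2)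
      · exact absurd ((dvd_sub_comm).1 hkl) (hdist l k hl.1 hl.2 hk.1 hk.2)
      · have := dvd_small q (k - l) hkl (by omega) (by omega)
        omega)
    x hF
  rw [Finset.sum_union hdisj] at hcore
  rw [← hcdef, ← hC, ← hV, ← hAdef, ← hHdef] at hcore
  -- final arithmetic
  have b1 : q * A ≤ q * (m * (L + ε / 8)) := by
    apply mul_le_mul_of_nonneg_left _ hq0.le
    linarith
  have b2 : C * (m * (q * H)) ≤ m * q * (ε / 16) := by
    have := mul_le_mul_of_nonneg_left hH (show 0 ≤ (m : ℝ) * q by positivity)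
    linarith
  have b3 : C * (m * (4 * (I * (2 * V)))) ≤ C * (m * (4 * ((2 * (δ * q) + 2) * (2 * V)))) := by
    gcongr
  have b4 : m * q * (δ * (16 * V * C + 4 * m)) ≤ m * q * (ε / 16) := by
    apply mul_le_mul_of_nonneg_left _ (by positivity)
    rw [← hδT, hT]
    nlinarith
  have b5 : R ≤ m * (ε * q / 4) := by
    have : 1 * (ε * q / 4) ≤ m * (ε * q / 4) := by gcongr
    linarith
  have fin : m * (lphi α f E N1 (x + k1 * α) + lphi α f E N2 (x + k2 * α)) ≤
      m * ((L + ε / 2) * q) := by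
    have hfin : 2 * m ^ 2 * D + 2 * m ^ 2 * D = 4 * m ^ 2 * c + 4 * m ^ 2 * (δ * q) := by
      rw [hD]; ring
    have h7 : m * q * (δ * (16 * V * C + 4 * m)) = 4 * m ^ 2 * (δ * q) +
      C * (m * (4 * ((2 * (δ * q)) * (2 * V)))) := by ring
    clear_value R D A H I T δ C J
    clear hF hg hx hL hdist ev1 ev2 hQ1 avg hJ hAdef hHdef
    linarith
  exact le_of_mul_le_mul_left fin (by linarith)

lemma norm_eq_exp (α : ℝ) (f : ℝ → ℝ) (E : ℝ) (m : ℕ) (y : ℝ) :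
    ‖schCocycle α f E m y‖ = Real.exp (lphi α f E m y) := by
  unfold lphi
  rw [Real.exp_log (lt_of_lt_of_le one_pos (coc_ge α f E m y))]

lemma tM_fwd (α : ℝ) (f : ℝ → ℝ) (E x : ℝ) (k : ℤ) (m : ℕ) (n : ℤ) (hn : n = k + m) :
    ‖tM (fun m : ℤ => (f (x + m * α) : ℂ)) (E : ℂ) n k‖ =
      Real.exp (lphi α f E m (x + k * α)) := by
  unfold tM
  rw [if_pos (by omega), tProd_eq α f E x k m n hn, norm_eq_exp]

lemma tM_bwd (α : ℝ) (f : ℝ → ℝ) (E x : ℝ) (k : ℤ) (m : ℕ) (n : ℤ) (hn : n = k + m) :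
    ‖tM (fun m : ℤ => (f (x + m * α) : ℂ)) (E : ℂ) k n‖ ≤
      2 * Real.exp (lphi α f E m (x + k * α)) := by
  rcases Nat.eq_zero_or_pos m with h | h
  · subst h
    have e : n = k := by simpa using hn
    subst e
    rw [tM_fwd α f E x n 0 n hn]
    linarith [Real.exp_pos (lphi α f E 0 (x + n * α))]
  · unfold tM
    rw [if_neg (by omega), tProd_eq α f E x k m n hn, ← norm_eq_exp]
    exact norm_inv_le _ (coc_det _ _ _ _ _)

/-- (Telescopic estimates for Schrödinger cocycles.) Let `α` be irrational
with continued-fraction denominators `q_k`, let `f` be `1`-periodic with `𝒱(f) < ∞` and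
`log(1+|f|) ∈ L¹[0,1)`, let `ε > 0`, and let `q_{n_j}` be a subsequence of denominators with
`Σ_j ∫_{{1+|f| > e^{ε q_{n_j}/10}}} log(1+|f|) < ∞`. Then for a full-measure set of
`x ∈ [0,1)` and every `E ∈ ℝ`, the sequence `{q_{n_j}}` is `(L(E)+ε)`-telescopic for the
potential `V(m) = f(x + mα)`. -/
theorem schrodinger_telescopic (α : ℝ) (hα : Irrational α) (f : ℝ → ℝ)
    (hper : Function.Periodic f 1) (hsv : sVar f ≠ ⊤)
    (hlog : IntegrableOn (fun x => Real.log (1 + |f x|)) (Set.Ico 0 1) volume)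
    (ε : ℝ) (hε : 0 < ε) (nj : ℕ → ℕ) (hmono : StrictMono nj)
    (hsum : ∑' j : ℕ,
        ∫⁻ x in {y ∈ Set.Ico (0:ℝ) 1 | Real.exp (ε * cfDen α (nj j) / 10) < 1 + |f y|},
          ENNReal.ofReal (Real.log (1 + |f x|)) < ⊤)
    (L : ℝ → ℝ)
    (hL : ∀ E : ℝ, Tendsto
      (fun m : ℕ => (1 / m : ℝ) * ∫ x in Set.Ico (0:ℝ) 1, Real.log ‖schCocycle α f E m x‖)
      atTop (nhds (L E))) :
    ∃ X : Set ℝ, X ⊆ Set.Ico 0 1 ∧ volume (Set.Ico (0:ℝ) 1 \ X) = 0 ∧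
      ∀ x ∈ X, ∀ E : ℝ,
        telescopic (fun m : ℤ => (f (x + m * α) : ℂ)) (E : ℂ) (L E + ε)
          (fun j => cfDen α (nj j)) := by
  have hm := f_measurable f hper hsv
  have hae := ae_good α f hper hm hlog
  refine ⟨{x ∈ Set.Ico (0:ℝ) 1 | GoodX α f x}, fun x hx => hx.1, ?_, ?_⟩
  · rw [ae_restrict_iff' measurableSet_Ico, ae_iff] at hae
    refine measure_mono_null ?_ hae
    intro x hx hx2
    exact hx.2 ⟨hx.1, hx2 hx.1⟩
  · intro x hx E
    obtain ⟨Q1, hQ1⟩ := two_seg α f hper hsv hlog E (L E) ε hε x hx.2 (hL E)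
    obtain ⟨Q2, hQ2⟩ := hx.2 (ε / 8) (by positivity)
    set c := Real.log (1 + |E|) with hc
    have hc0 : 0 ≤ c := log_nonneg' E
    obtain ⟨Q3, hQ3⟩ := exists_nat_ge ((4 + c) * 4 / ε)
    refine ⟨max Q1 (max Q2 Q3), ?_⟩
    intro n hn s hs0 hsq
    beta_reduce at hsq ⊢
    have hge : n ≤ cfDen α (nj n) := (hmono.le_apply).trans (cfDen_ge α hα (nj n))
    have hq0 := cfDen_pos α hα (nj n)
    obtain ⟨p, hcop, happ⟩ := cf_approx α hα (nj n)
    set q := cfDen α (nj n) with hq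
    have hq1 : Q1 ≤ q := ((le_max_left _ _).trans hn).trans hge
    have hq2 : Q2 ≤ q := (((le_max_left _ _).trans (le_max_right _ _)).trans hn).trans hge
    have hq3 : Q3 ≤ q := (((le_max_right _ _).trans (le_max_right _ _)).trans hn).trans hge
    have hq3' : (Q3 : ℝ) ≤ q := by exact_mod_cast hq3
    have hbig : 4 + c ≤ ε / 4 * q := by
      rw [div_le_iff₀ hε] at hQ3
      nlinarith
    have seg := hQ1 q hq1 hq0 p hcop happ
    have hqR : (0 : ℝ) < q := by exact_mod_cast hq0
    have hεq : 0 < ε * q := mul_pos hε hqR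
    have h4 : (4 : ℝ) ≤ Real.exp 4 := by linarith [Real.add_one_le_exp (4 : ℝ)]
    obtain ⟨t, rfl⟩ := Int.eq_ofNat_of_zero_le hs0
    have htq : t < q := by omega
    constructor
    · rw [tM_fwd α f E x (q + t + 1) (q - t - 1) (2 * q) (by omega),
        tM_fwd α f E x 0 t t (by omega), ← Real.exp_add]
      apply Real.exp_le_exp.2
      have := seg (q + t + 1) (q - t - 1) 0 t (by omega) (by omega) (by omega) (by omega)
        (by omega) (by omega) (by
          intro a b ha1 ha2 hb1 hb2 hd
          have := dvd_small q (a - b - q) (dvd_sub hd (dvd_refl _)) (by omega) (by omega)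
          omega)
      refine this.trans ?_
      linarith
    · rcases Nat.eq_zero_or_pos t with h | h
      · subst h
        have g1 := tM_fwd α f E x (-(q : ℤ) + (0 : ℕ) - 1) 1 (-(q : ℤ)) (by push_cast; ring)
        have g2 := tM_bwd α f E x 0 q q (by omega)
        rw [g1]
        have g3 := lphi_one α f E (x + ((-(q : ℤ) + (0 : ℕ) - 1 : ℤ) : ℝ) * α)
        have g4 := hQ2 q hq2 (-(q : ℤ) + (0 : ℕ) - 1) (by rw [abs_le]; constructor <;> omega)
        have g5 := g3.trans (add_le_add le_rfl g4)
        rw [← hc] at g5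
        clear g3 g4
        have := seg 0 q 0 0 (by omega) (by omega) (by omega) (by omega)
          (by omega) (by omega) (by
            intro a b ha1 ha2 hb1 hb2 hd
            omega)
        rw [lphi_zero] at this
        set u := lphi α f E 1 (x + ((-(q : ℤ) + (0 : ℕ) - 1 : ℤ) : ℝ) * α)
        set w := lphi α f E q (x + ((0 : ℤ) : ℝ) * α)
        calc _ ≤ Real.exp u * (2 * Real.exp w) :=
              mul_le_mul_of_nonneg_left g2 (Real.exp_pos _).le
          _ = 2 * Real.exp (u + w) := by rw [Real.exp_add]; ring
          _ ≤ Real.exp 4 * Real.exp (u + w) := by gcongr; linarith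
          _ = Real.exp (4 + (u + w)) := by rw [Real.exp_add 4]
          _ ≤ _ := by
              apply Real.exp_le_exp.2
              linarith
      · have g1 := tM_bwd α f E x (-(q : ℤ)) (t - 1) (-(q : ℤ) + t - 1) (by omega)
        have g2 := tM_bwd α f E x t (q - t) q (by omega)
        have := seg (-(q : ℤ)) (t - 1) t (q - t) (by omega) (by omega) (by omega) (by omega)
          (by omega) (by omega) (by
            intro a b ha1 ha2 hb1 hb2 hd
            have := dvd_small q (a - b + q) (dvd_add hd (dvd_refl _)) (by omega) (by omega)
            omega)
        set u := lphi α f E (t - 1) (x + ((-(q : ℤ) : ℤ) : ℝ) * α)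
        set w := lphi α f E (q - t) (x + ((t : ℤ) : ℝ) * α)
        calc _ ≤ (2 * Real.exp u) * (2 * Real.exp w) := by
              apply mul_le_mul g1 g2 (norm_nonneg _) (by positivity)
          _ = 4 * Real.exp (u + w) := by rw [Real.exp_add]; ring
          _ ≤ Real.exp 4 * Real.exp (u + w) := by gcongr
          _ = Real.exp (4 + (u + w)) := by rw [Real.exp_add 4]
          _ ≤ _ := by
              apply Real.exp_le_exp.2
              linarith
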